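/- arXiv:math/9811129 — 3 statements merged into one kernel-verified Lean document; each statement's English description precedes it below -/
import Mathlib

section
/- In the hyperoctahedral setting, the two linear maps ch: h_∓ (C·S_{2n}) h_± → Λ_M defined by ch(h_- σ h_+) = ch(h_+ σ h_-) = 2^{ℓ(ρ)} p_ρ(x_1²,...,x_M²) for any permutation σ of {1,...,n} with cycle lengths 2ρ_1, 2ρ_2, ... are well defined: the elements h_∓ σ h_± depend only on the double coset H_n σ H_n, every double coset of H_n in S_{2n} contains a permutation acting trivially on n+1,...,2n, and h_- σ h_+ = h_+ σ h_- = 0 whenever σ (a permutation of 1,...,n) has an odd cycle. -/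
open MonoidAlgebra

/-- The index `p` in the lower half `{1,…,n}` of `{1,…,2n}`. -/
def lowIdx (n : ℕ) (q : Fin n) : Fin (n + n) := finSumFinEquiv (Sum.inl q)

/-- The index `n + p` in the upper half of `{1,…,2n}`. -/
def highIdx (n : ℕ) (q : Fin n) : Fin (n + n) := finSumFinEquiv (Sum.inr q)

/-- The embedding `S_n → S_{2n}` as permutations of the lower half `{1,…,n}`. -/
def embLow (n : ℕ) (σ : Equiv.Perm (Fin n)) : Equiv.Perm (Fin (n + n)) :=
  finSumFinEquiv.permCongr (Equiv.sumCongr σ (Equiv.refl (Fin n)))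

/-- The involution `(1,n+1)(2,n+2)⋯(n,2n)`. -/
def pairInvolution (n : ℕ) : Equiv.Perm (Fin (n + n)) :=
  finSumFinEquiv.permCongr (Equiv.sumComm (Fin n) (Fin n))

/-- The hyperoctahedral group `H_n ⊂ S_{2n}`, the centralizer of
`(1,n+1)⋯(n,2n)`, as a finite set of permutations. -/
def hyperoctahedral (n : ℕ) : Finset (Equiv.Perm (Fin (n + n))) :=
  Finset.univ.filter (fun σ => σ * pairInvolution n = pairInvolution n * σ)

/-- The character `χ₋` of `H_n`: trivial on `S_n` and `= -1` on each `(s, n+s)`. -/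
noncomputable def chiMinus (n : ℕ) (σ : Equiv.Perm (Fin (n + n))) : ℂ :=
  (-1 : ℂ) ^ (Finset.univ.filter
    (fun q : Fin n => ∃ r : Fin n, σ (lowIdx n q) = highIdx n r)).card

/-- The idempotent `h₊ = (1/(n! 2^n)) Σ_{σ ∈ H_n} σ`. -/
noncomputable def hPlus (n : ℕ) : MonoidAlgebra ℂ (Equiv.Perm (Fin (n + n))) :=
  ((n.factorial : ℂ) * 2 ^ n)⁻¹ •
    ∑ σ ∈ hyperoctahedral n, MonoidAlgebra.of ℂ (Equiv.Perm (Fin (n + n))) σ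

/-- The idempotent `h₋ = (1/(n! 2^n)) Σ_{σ ∈ H_n} χ₋(σ) σ`. -/
noncomputable def hMinus (n : ℕ) : MonoidAlgebra ℂ (Equiv.Perm (Fin (n + n))) :=
  ((n.factorial : ℂ) * 2 ^ n)⁻¹ •
    ∑ σ ∈ hyperoctahedral n, chiMinus n σ • MonoidAlgebra.of ℂ (Equiv.Perm (Fin (n + n))) σ

/-- The linear map `y ↦ h₋ · y · h₊` on `ℂ·S_{2n}`. -/
noncomputable def sandwichMP (n : ℕ) :
    MonoidAlgebra ℂ (Equiv.Perm (Fin (n + n))) →ₗ[ℂ] MonoidAlgebra ℂ (Equiv.Perm (Fin (n + n))) :=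
  (LinearMap.mulLeft ℂ (hMinus n)).comp (LinearMap.mulRight ℂ (hPlus n))

/-- The linear map `y ↦ h₊ · y · h₋` on `ℂ·S_{2n}`. -/
noncomputable def sandwichPM (n : ℕ) :
    MonoidAlgebra ℂ (Equiv.Perm (Fin (n + n))) →ₗ[ℂ] MonoidAlgebra ℂ (Equiv.Perm (Fin (n + n))) :=
  (LinearMap.mulLeft ℂ (hPlus n)).comp (LinearMap.mulRight ℂ (hMinus n))

/-- The power sum `p_ρ(x_1²,…,x_M²) = ∏_k (x_1^{2ρ_k} + ⋯ + x_M^{2ρ_k})`. -/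
noncomputable def powerSumSq (M : ℕ) (ρ : Multiset ℕ) : MvPolynomial (Fin M) ℂ :=
  (ρ.map (fun k => ∑ i : Fin M, (MvPolynomial.X i) ^ (2 * k))).prod


/-! ### Basic lemmas on indices -/

lemma idx_cases (n : ℕ) (x : Fin (n + n)) :
    (∃ q, x = lowIdx n q) ∨ (∃ q, x = highIdx n q) := by
  obtain ⟨y, rfl⟩ := (finSumFinEquiv (m := n) (n := n)).surjective x
  rcases y with q | q
  · exact Or.inl ⟨q, rfl⟩
  · exact Or.inr ⟨q, rfl⟩

lemma low_inj {n : ℕ} {p q : Fin n} : lowIdx n p = lowIdx n q ↔ p = q := by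
  simp [lowIdx]

lemma high_inj {n : ℕ} {p q : Fin n} : highIdx n p = highIdx n q ↔ p = q := by
  simp only [highIdx, EmbeddingLike.apply_eq_iff_eq, Sum.inr.injEq]

lemma low_ne_high {n : ℕ} {p q : Fin n} : lowIdx n p ≠ highIdx n q := by
  simp only [lowIdx, highIdx, ne_eq, EmbeddingLike.apply_eq_iff_eq, reduceCtorEq,
    not_false_eq_true]

lemma high_ne_low {n : ℕ} {p q : Fin n} : highIdx n p ≠ lowIdx n q :=
  fun h => low_ne_high h.symm

lemma emb_low {n : ℕ} (σ : Equiv.Perm (Fin n)) (q : Fin n) :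
    embLow n σ (lowIdx n q) = lowIdx n (σ q) := by
  simp only [embLow, lowIdx, Equiv.permCongr_apply, Equiv.symm_apply_apply, Equiv.sumCongr_apply,
    Sum.map_inl]

lemma emb_high {n : ℕ} (σ : Equiv.Perm (Fin n)) (q : Fin n) :
    embLow n σ (highIdx n q) = highIdx n q := by
  simp only [embLow, highIdx, Equiv.permCongr_apply, Equiv.symm_apply_apply,
    Equiv.sumCongr_apply, Sum.map_inr, Equiv.refl_apply]

lemma pi_low {n : ℕ} (q : Fin n) : pairInvolution n (lowIdx n q) = highIdx n q := by
  simp only [pairInvolution, lowIdx, highIdx, Equiv.permCongr_apply, Equiv.symm_apply_apply,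
    Equiv.sumComm_apply, Sum.swap_inl]

lemma pi_high {n : ℕ} (q : Fin n) : pairInvolution n (highIdx n q) = lowIdx n q := by
  simp only [pairInvolution, lowIdx, highIdx, Equiv.permCongr_apply, Equiv.symm_apply_apply,
    Equiv.sumComm_apply, Sum.swap_inr]

lemma pi_pi {n : ℕ} (x : Fin (n + n)) : pairInvolution n (pairInvolution n x) = x := by
  rcases idx_cases n x with ⟨q, rfl⟩ | ⟨q, rfl⟩ <;> simp only [pi_low, pi_high]

lemma pi_ne {n : ℕ} (x : Fin (n + n)) : pairInvolution n x ≠ x := by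
  rcases idx_cases n x with ⟨q, rfl⟩ | ⟨q, rfl⟩
  · rw [pi_low]; exact high_ne_low
  · rw [pi_high]; exact low_ne_high

lemma mem_H {n : ℕ} {h : Equiv.Perm (Fin (n + n))} :
    h ∈ hyperoctahedral n ↔ ∀ x, h (pairInvolution n x) = pairInvolution n (h x) := by
  simp [hyperoctahedral, Equiv.ext_iff]

lemma H_mul {n : ℕ} {h k : Equiv.Perm (Fin (n + n))} (hh : h ∈ hyperoctahedral n)
    (hk : k ∈ hyperoctahedral n) : h * k ∈ hyperoctahedral n := by
  rw [mem_H] at *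
  intro x
  simp [hh, hk]

lemma H_inv {n : ℕ} {h : Equiv.Perm (Fin (n + n))} (hh : h ∈ hyperoctahedral n) :
    h⁻¹ ∈ hyperoctahedral n := by
  rw [mem_H] at *
  intro x
  rw [Equiv.Perm.inv_eq_iff_eq, hh]
  simp

lemma H_one {n : ℕ} : (1 : Equiv.Perm (Fin (n + n))) ∈ hyperoctahedral n := by
  rw [mem_H]; intro x; rfl

lemma emb_inv {n : ℕ} (σ : Equiv.Perm (Fin n)) : (embLow n σ)⁻¹ = embLow n σ⁻¹ := by
  ext1 x
  rw [Equiv.Perm.inv_eq_iff_eq]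
  rcases idx_cases n x with ⟨q, rfl⟩ | ⟨q, rfl⟩ <;> simp [emb_low, emb_high]

/-! ### The character -/

/-- The pair index of a point. -/
def pairIdx (n : ℕ) (x : Fin (n + n)) : Fin n :=
  Sum.elim id id ((finSumFinEquiv (m := n) (n := n)).symm x)

lemma pairIdx_low {n : ℕ} (q : Fin n) : pairIdx n (lowIdx n q) = q := by
  simp only [pairIdx, lowIdx, Equiv.symm_apply_apply, Sum.elim_inl, id]

lemma pairIdx_high {n : ℕ} (q : Fin n) : pairIdx n (highIdx n q) = q := by
  simp only [pairIdx, highIdx, Equiv.symm_apply_apply, Sum.elim_inr, id]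

lemma pairIdx_eq {n : ℕ} {x y : Fin (n + n)} (h : pairIdx n x = pairIdx n y) :
    x = y ∨ x = pairInvolution n y := by
  rcases idx_cases n x with ⟨q, rfl⟩ | ⟨q, rfl⟩ <;> rcases idx_cases n y with ⟨r, rfl⟩ | ⟨r, rfl⟩
  all_goals
    simp only [pairIdx_low, pairIdx_high] at h
    subst h
    simp [pi_low, pi_high]

lemma prod_H {n : ℕ} {R : Type*} [CommRing R] (g : Fin (n + n) → R)
    (hg : ∀ x, g (pairInvolution n x) = - g x) {h : Equiv.Perm (Fin (n + n))}
    (hh : h ∈ hyperoctahedral n) :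
    ∏ q : Fin n, g (h (lowIdx n q)) = (-1 : R) ^ (Finset.univ.filter
      (fun q : Fin n => ∃ r : Fin n, h (lowIdx n q) = highIdx n r)).card *
      ∏ q : Fin n, g (lowIdx n q) := by
  classical
  rw [mem_H] at hh
  have hinj : Function.Injective (fun q => pairIdx n (h (lowIdx n q))) := by
    intro p q hpq
    rcases pairIdx_eq hpq with h1 | h1
    · exact low_inj.1 (h.injective h1)
    · rw [← hh, pi_low] at h1
      exact absurd (h.injective h1) low_ne_high
  have hbij := Finite.injective_iff_bijective.1 hinj
  have key : ∀ q, g (h (lowIdx n q)) =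
      (if ∃ r : Fin n, h (lowIdx n q) = highIdx n r then (-1 : R) else 1) *
        g (lowIdx n (pairIdx n (h (lowIdx n q)))) := by
    intro q
    rcases idx_cases n (h (lowIdx n q)) with ⟨r, hr⟩ | ⟨r, hr⟩
    · rw [hr, if_neg, pairIdx_low, one_mul]
      rintro ⟨s, hs⟩
      exact low_ne_high hs
    · rw [hr, if_pos ⟨r, rfl⟩, pairIdx_high, ← pi_low, hg, neg_one_mul]
  rw [Finset.prod_congr rfl (fun q _ => key q), Finset.prod_mul_distrib]
  congr 1
  · rw [Finset.prod_ite]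
    simp
  · exact hbij.prod_comp (fun q => g (lowIdx n q))

/-- The sign of a point: `1` on the lower half and `-1` on the upper half. -/
noncomputable def ptSign (n : ℕ) (x : Fin (n + n)) : ℂ :=
  Sum.elim (fun _ => 1) (fun _ => -1) ((finSumFinEquiv (m := n) (n := n)).symm x)

lemma ptSign_low {n : ℕ} (q : Fin n) : ptSign n (lowIdx n q) = 1 := by
  simp only [ptSign, lowIdx, Equiv.symm_apply_apply, Sum.elim_inl]

lemma ptSign_high {n : ℕ} (q : Fin n) : ptSign n (highIdx n q) = -1 := by
  simp only [ptSign, highIdx, Equiv.symm_apply_apply, Sum.elim_inr]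

lemma ptSign_pi {n : ℕ} (x : Fin (n + n)) : ptSign n (pairInvolution n x) = - ptSign n x := by
  rcases idx_cases n x with ⟨q, rfl⟩ | ⟨q, rfl⟩ <;>
    simp [pi_low, pi_high, ptSign_low, ptSign_high]

lemma chi_eq_prod {n : ℕ} {h : Equiv.Perm (Fin (n + n))} (hh : h ∈ hyperoctahedral n) :
    chiMinus n h = ∏ q : Fin n, ptSign n (h (lowIdx n q)) := by
  rw [prod_H _ ptSign_pi hh]
  simp [ptSign_low, chiMinus]

lemma chi_mul {n : ℕ} {h k : Equiv.Perm (Fin (n + n))} (hh : h ∈ hyperoctahedral n)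
    (hk : k ∈ hyperoctahedral n) : chiMinus n (h * k) = chiMinus n h * chiMinus n k := by
  rw [chi_eq_prod (H_mul hh hk)]
  have := prod_H (fun x => ptSign n (h x)) (fun x => by
    rw [mem_H.1 hh, ptSign_pi]) hk
  simp only [Equiv.Perm.mul_apply]
  rw [this, ← chi_eq_prod hh, mul_comm]
  rfl

lemma chi_sq {n : ℕ} (h : Equiv.Perm (Fin (n + n))) : chiMinus n h * chiMinus n h = 1 := by
  rw [chiMinus, ← mul_pow]; simp

lemma chi_one {n : ℕ} : chiMinus n 1 = 1 := by
  rw [chi_eq_prod H_one]; simp [ptSign_low]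

lemma chi_inv {n : ℕ} {h : Equiv.Perm (Fin (n + n))} (hh : h ∈ hyperoctahedral n) :
    chiMinus n h⁻¹ = chiMinus n h := by
  have h1 := chi_mul hh (H_inv hh)
  rw [mul_inv_cancel, chi_one] at h1
  have h2 := chi_sq h
  calc _ = chiMinus n h * chiMinus n h * chiMinus n h⁻¹ := by rw [h2, one_mul]
    _ = _ := by rw [mul_assoc, ← h1, mul_one]

/-! ### Generic averaging argument -/

section generic
variable {G : Type*} [Group G] (H : Finset G) (χ ψ : G → ℂ)

/-- The unnormalised-by-`c` sum attached to a character. -/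
noncomputable def avg (c : ℂ) : MonoidAlgebra ℂ G := c • ∑ σ ∈ H, χ σ • MonoidAlgebra.of ℂ G σ

lemma avg_mul_of (Hm : ∀ h ∈ H, ∀ k ∈ H, h * k ∈ H) (Hi : ∀ h ∈ H, h⁻¹ ∈ H)
    (χm : ∀ h ∈ H, ∀ k ∈ H, χ (h * k) = χ h * χ k) (χs : ∀ h ∈ H, χ h * χ h = 1)
    (c : ℂ) {h : G} (hh : h ∈ H) :
    avg H χ c * MonoidAlgebra.of ℂ G h = χ h • avg H χ c := by
  unfold avg
  rw [smul_mul_assoc, smul_comm (χ h)]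
  congr 1
  rw [Finset.sum_mul, Finset.smul_sum]
  refine Finset.sum_bij' (fun g _ => g * h) (fun g _ => g * h⁻¹) (fun g hg => Hm g hg h hh)
    (fun g hg => Hm g hg _ (Hi h hh)) (by simp) (by simp) ?_
  intro g hg
  rw [smul_mul_assoc, ← map_mul, smul_smul, χm g hg h hh, mul_comm (χ h), mul_assoc, χs h hh,
    mul_one]

lemma of_mul_avg (Hm : ∀ h ∈ H, ∀ k ∈ H, h * k ∈ H) (Hi : ∀ h ∈ H, h⁻¹ ∈ H)
    (χm : ∀ h ∈ H, ∀ k ∈ H, χ (h * k) = χ h * χ k) (χs : ∀ h ∈ H, χ h * χ h = 1)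
    (c : ℂ) {h : G} (hh : h ∈ H) :
    MonoidAlgebra.of ℂ G h * avg H χ c = χ h • avg H χ c := by
  unfold avg
  rw [mul_smul_comm, smul_comm (χ h)]
  congr 1
  rw [Finset.mul_sum, Finset.smul_sum]
  refine Finset.sum_bij' (fun g _ => h * g) (fun g _ => h⁻¹ * g) (fun g hg => Hm h hh g hg)
    (fun g hg => Hm _ (Hi h hh) g hg) (by simp) (by simp) ?_
  intro g hg
  rw [mul_smul_comm, ← map_mul, smul_smul, χm h hh g hg, ← mul_assoc, χs h hh, one_mul]

/-- A bi-equivariant function extends to a linear map compatible with the sandwich. -/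
lemma lift_sandwich {V : Type*} [AddCommGroup V] [Module ℂ V] (f : G → V)
    (χs : ∀ h ∈ H, χ h * χ h = 1) (ψs : ∀ h ∈ H, ψ h * ψ h = 1)
    (hf : ∀ h ∈ H, ∀ k ∈ H, ∀ t, f (h * t * k) = (χ h * ψ k) • f t) (c : ℂ) :
    ∃ F : MonoidAlgebra ℂ G →ₗ[ℂ] V, (∀ t, F (MonoidAlgebra.of ℂ G t) = f t) ∧
      ∀ t, F (avg H χ c * MonoidAlgebra.of ℂ G t * avg H ψ c) =
        (c * H.card * (c * H.card)) • f t := by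
  obtain ⟨F, hF⟩ : ∃ F : MonoidAlgebra ℂ G →ₗ[ℂ] V,
      (∀ t, F (MonoidAlgebra.of ℂ G t) = f t) := by
    refine ⟨(MonoidAlgebra.basis G ℂ).constr ℂ f, fun t => ?_⟩
    have := (MonoidAlgebra.basis G ℂ).constr_basis ℂ f t
    simpa using this
  refine ⟨F, hF, fun t => ?_⟩
  unfold avg
  have e : (c • ∑ σ ∈ H, χ σ • MonoidAlgebra.of ℂ G σ) * MonoidAlgebra.of ℂ G t *
      (c • ∑ σ ∈ H, ψ σ • MonoidAlgebra.of ℂ G σ) =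
      (c * c) • ∑ h ∈ H, ∑ k ∈ H, (χ h * ψ k) • MonoidAlgebra.of ℂ G (h * t * k) := by
    rw [smul_mul_assoc, smul_mul_assoc, mul_smul_comm, smul_smul, Finset.sum_mul, Finset.sum_mul]
    congr 1
    refine Finset.sum_congr rfl fun h _ => ?_
    rw [Finset.mul_sum]
    refine Finset.sum_congr rfl fun k _ => ?_
    rw [smul_mul_assoc, smul_mul_assoc, mul_smul_comm, smul_smul, map_mul, map_mul]
  rw [e]
  simp only [map_smul, map_sum, hF]
  have : ∀ h ∈ H, ∀ k ∈ H, (χ h * ψ k) • f (h * t * k) = f t := by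
    intro h hh k hk
    rw [hf h hh k hk, smul_smul]
    have : χ h * ψ k * (χ h * ψ k) = (χ h * χ h) * (ψ k * ψ k) := by ring
    rw [this, χs h hh, ψs k hk]; simp
  rw [Finset.sum_congr rfl (fun h hh => Finset.sum_congr rfl (fun k hk => this h hh k hk))]
  simp only [Finset.sum_const, smul_smul, ← Nat.cast_smul_eq_nsmul ℂ]
  congr 1
  ring

lemma sandwich_of (Hm : ∀ h ∈ H, ∀ k ∈ H, h * k ∈ H) (Hi : ∀ h ∈ H, h⁻¹ ∈ H)
    (χm : ∀ h ∈ H, ∀ k ∈ H, χ (h * k) = χ h * χ k) (χs : ∀ h ∈ H, χ h * χ h = 1)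
    (ψm : ∀ h ∈ H, ∀ k ∈ H, ψ (h * k) = ψ h * ψ k) (ψs : ∀ h ∈ H, ψ h * ψ h = 1)
    (c : ℂ) {h k : G} (hh : h ∈ H) (hk : k ∈ H) (t : G) :
    avg H χ c * MonoidAlgebra.of ℂ G (h * t * k) * avg H ψ c =
      (χ h * ψ k) • (avg H χ c * MonoidAlgebra.of ℂ G t * avg H ψ c) := by
  have : avg H χ c * MonoidAlgebra.of ℂ G (h * t * k) * avg H ψ c =
      (avg H χ c * MonoidAlgebra.of ℂ G h) * MonoidAlgebra.of ℂ G t *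
        (MonoidAlgebra.of ℂ G k * avg H ψ c) := by
    rw [map_mul, map_mul]; simp only [mul_assoc]
  rw [this, avg_mul_of H χ Hm Hi χm χs c hh, of_mul_avg H ψ Hm Hi ψm ψs c hk]
  simp only [smul_mul_assoc, mul_smul_comm, smul_smul]
  rw [mul_comm]

lemma sandwich_zero (Hm : ∀ h ∈ H, ∀ k ∈ H, h * k ∈ H) (Hi : ∀ h ∈ H, h⁻¹ ∈ H)
    (χm : ∀ h ∈ H, ∀ k ∈ H, χ (h * k) = χ h * χ k) (χs : ∀ h ∈ H, χ h * χ h = 1)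
    (ψm : ∀ h ∈ H, ∀ k ∈ H, ψ (h * k) = ψ h * ψ k) (ψs : ∀ h ∈ H, ψ h * ψ h = 1)
    (c : ℂ) {h k : G} (hh : h ∈ H) (hk : k ∈ H) (t : G) (ht : h * t * k = t)
    (hs : χ h * ψ k = -1) :
    avg H χ c * MonoidAlgebra.of ℂ G t * avg H ψ c = 0 := by
  have h1 := sandwich_of H χ ψ Hm Hi χm χs ψm ψs c hh hk t
  rw [ht, hs, neg_smul, one_smul] at h1
  have h2 : (2 : ℂ) • (avg H χ c * MonoidAlgebra.of ℂ G t * avg H ψ c) = 0 := by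
    rw [two_smul]; nth_rewrite 1 [h1]; exact neg_add_cancel _
  exact (smul_eq_zero.1 h2).resolve_left two_ne_zero

lemma exists_unique_ch {V ι P : Type*} [AddCommGroup V] [Module ℂ V]
    (H1 : (1 : G) ∈ H)
    (Hm : ∀ h ∈ H, ∀ k ∈ H, h * k ∈ H) (Hi : ∀ h ∈ H, h⁻¹ ∈ H)
    (χm : ∀ h ∈ H, ∀ k ∈ H, χ (h * k) = χ h * χ k) (χs : ∀ h ∈ H, χ h * χ h = 1)
    (ψm : ∀ h ∈ H, ∀ k ∈ H, ψ (h * k) = ψ h * ψ k) (ψs : ∀ h ∈ H, ψ h * ψ h = 1)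
    (c : ℂ) (hc : c ≠ 0) (S : MonoidAlgebra ℂ G →ₗ[ℂ] MonoidAlgebra ℂ G)
    (hS : ∀ y, S y = avg H χ c * y * avg H ψ c)
    (emb : ι → G) (good : ι → P → Prop) (v : P → V)
    (cov : ∀ t, ∃ s, ∃ h ∈ H, ∃ k ∈ H, t = h * emb s * k)
    (f : G → V) (hf : ∀ h ∈ H, ∀ k ∈ H, ∀ t, f (h * t * k) = (χ h * ψ k) • f t)
    (hv : ∀ s ρ, good s ρ → f (emb s) = v ρ)
    (hd : ∀ s, (∃ ρ, good s ρ) ∨ S (MonoidAlgebra.of ℂ G (emb s)) = 0) :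
    ∃! ch : ↥(LinearMap.range S) →ₗ[ℂ] V, ∀ s ρ, good s ρ →
      ch ⟨S (MonoidAlgebra.of ℂ G (emb s)), LinearMap.mem_range_self _ _⟩ = v ρ := by
  obtain ⟨F, -, hF⟩ := lift_sandwich H χ ψ f χs ψs hf c
  have hcard : (c * H.card * (c * H.card)) ≠ 0 := by
    have : (H.card : ℂ) ≠ 0 := by
      exact_mod_cast Finset.card_ne_zero_of_mem H1
    simp [hc, this]
  refine ⟨(c * H.card * (c * H.card))⁻¹ • F.comp (LinearMap.range S).subtype, ?_, ?_⟩
  · intro s ρ hg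
    simp only [LinearMap.smul_apply, LinearMap.comp_apply, Submodule.subtype_apply, hS, hF]
    rw [smul_smul, inv_mul_cancel₀ hcard, one_smul, hv s ρ hg]
  · have main : ∀ ch ch' : ↥(LinearMap.range S) →ₗ[ℂ] V,
        (∀ s ρ, good s ρ →
          ch ⟨S (MonoidAlgebra.of ℂ G (emb s)), LinearMap.mem_range_self _ _⟩ = v ρ) →
        (∀ s ρ, good s ρ →
          ch' ⟨S (MonoidAlgebra.of ℂ G (emb s)), LinearMap.mem_range_self _ _⟩ = v ρ) →
        ch = ch' := by
      intro ch ch' h1 h2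
      have key : ch.comp S.rangeRestrict = ch'.comp S.rangeRestrict := by
        refine (MonoidAlgebra.basis G ℂ).ext fun t => ?_
        have hb : MonoidAlgebra.basis G ℂ t = MonoidAlgebra.of ℂ G t := by simp
        rw [hb]
        obtain ⟨s, h, hh, k, hk, rfl⟩ := cov t
        have e : S.rangeRestrict (MonoidAlgebra.of ℂ G (h * emb s * k)) =
            (χ h * ψ k) • S.rangeRestrict (MonoidAlgebra.of ℂ G (emb s)) := by
          apply Subtype.ext
          have e1 := sandwich_of H χ ψ Hm Hi χm χs ψm ψs c hh hk (emb s)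
          rw [← hS, ← hS] at e1
          exact e1
        simp only [LinearMap.comp_apply, e, map_smul]
        congr 1
        rcases hd s with ⟨ρ, hρ⟩ | h0
        · exact (h1 s ρ hρ).trans (h2 s ρ hρ).symm
        · have : S.rangeRestrict (MonoidAlgebra.of ℂ G (emb s)) = 0 := Subtype.ext h0
          rw [this, map_zero, map_zero]
      ext ⟨_, y, rfl⟩
      exact LinearMap.congr_fun key y
    intro ch' h'
    refine main _ _ h' ?_
    intro s ρ hg
    simp only [LinearMap.smul_apply, LinearMap.comp_apply, Submodule.subtype_apply, hS, hF]
    rw [smul_smul, inv_mul_cancel₀ hcard, one_smul, hv s ρ hg]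
end generic

/-! ### Invariant functions -/

lemma inv_sameCycle {α I : Type*} [Finite α] {σ : Equiv.Perm α} {b : α → I}
    (hb : ∀ q, b (σ q) = b q) {x z : α} (h : σ.SameCycle x z) : b x = b z := by
  obtain ⟨i, rfl⟩ := h.exists_nat_pow_eq
  induction i with
  | zero => rfl
  | succ i ih =>
    rw [pow_succ', Equiv.Perm.mul_apply, hb]
    exact ih ⟨i, rfl⟩

lemma sum_invariant {α I R : Type*} [Fintype α] [DecidableEq α] [Fintype I] [DecidableEq I]
    [CommRing R] (σ : Equiv.Perm α) (hσ : ∀ x, σ x ≠ x) (y : I → R) :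
    ∑ b ∈ Finset.univ.filter (fun b : α → I => ∀ q, b (σ q) = b q), ∏ q, y (b q) =
      (σ.cycleType.map (fun k => ∑ u, y u ^ k)).prod := by
  classical
  have hmem : ∀ q, σ.cycleOf q ∈ σ.cycleFactorsFinset := fun q =>
    Equiv.Perm.cycleOf_mem_cycleFactorsFinset_iff.2 (Equiv.Perm.mem_support.2 (hσ q))
  let cyc : α → σ.cycleFactorsFinset := fun q => ⟨σ.cycleOf q, hmem q⟩
  have hpt : ∀ c : σ.cycleFactorsFinset, ∃ q, cyc q = c := by
    intro c
    obtain ⟨x, hx⟩ := (Equiv.Perm.mem_cycleFactorsFinset_iff.1 c.2).1.nonempty_support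
    exact ⟨x, Subtype.ext (Equiv.Perm.cycle_is_cycleOf hx c.2).symm⟩
  have hcyc : ∀ q, cyc (σ q) = cyc q := by
    intro q
    apply Subtype.ext
    exact (Equiv.Perm.SameCycle.cycleOf_eq ⟨1, by simp⟩).symm
  have hsame : ∀ p q, cyc p = cyc q → σ.SameCycle p q := by
    intro p q h
    exact (Equiv.Perm.sameCycle_iff_cycleOf_eq_of_mem_support
      (Equiv.Perm.mem_support.2 (hσ p)) (Equiv.Perm.mem_support.2 (hσ q))).2
      (congrArg Subtype.val h)
  have hfib : ∀ c : σ.cycleFactorsFinset, Finset.univ.filter (fun q => cyc q = c) =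
      (c : Equiv.Perm α).support := by
    intro c
    ext q
    simp only [Finset.mem_filter, Finset.mem_univ, true_and]
    constructor
    · rintro rfl
      simp [cyc, Equiv.Perm.mem_support_cycleOf_iff, hσ q]
    · intro hq
      exact Subtype.ext (Equiv.Perm.cycle_is_cycleOf hq c.2).symm
  have hR : (σ.cycleType.map (fun k => ∑ u, y u ^ k)).prod =
      ∏ c : σ.cycleFactorsFinset, ∑ u, y u ^ (c : Equiv.Perm α).support.card := by
    rw [Equiv.Perm.cycleType_def, Multiset.map_map]
    rw [Finset.prod_coe_sort σ.cycleFactorsFinset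
      (fun c : Equiv.Perm α => ∑ u, y u ^ c.support.card)]
    rfl
  rw [hR, Finset.prod_univ_sum, Fintype.piFinset_univ]
  symm
  refine Finset.sum_bij (fun φ _ => fun q => φ (cyc q)) ?_ ?_ ?_ ?_
  · intro φ _
    simp [hcyc]
  · intro φ _ φ' _ h
    funext c
    obtain ⟨q, rfl⟩ := hpt c
    exact congrFun h q
  · intro b hb
    simp only [Finset.mem_filter, Finset.mem_univ, true_and] at hb
    choose pt hpt using hpt
    refine ⟨fun c => b (pt c), Finset.mem_univ _, ?_⟩
    funext q
    exact inv_sameCycle hb (hsame _ _ (hpt _))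
  · intro φ _
    rw [← Finset.prod_fiberwise Finset.univ cyc (fun q => y (φ (cyc q)))]
    refine Finset.prod_congr rfl fun c _ => ?_
    rw [← hfib c]
    rw [Finset.prod_congr rfl (g := fun _ => y (φ c))]
    · simp
    · intro q hq
      rw [(Finset.mem_filter.1 hq).2]

/-! ### Odd cycles -/

lemma odd_data {n : ℕ} (σ : Equiv.Perm (Fin n))
    (hσ : (∃ x, σ x = x) ∨ ∃ k ∈ σ.cycleType, Odd k) :
    ∃ (C : Finset (Fin n)) (g : Equiv.Perm (Fin n)), Odd C.card ∧ (∀ q, g q ∈ C ↔ q ∈ C) ∧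
      (∀ q, σ q ∈ C ↔ q ∈ C) ∧ ∀ q ∈ C, σ (g (σ q)) = g q := by
  rcases hσ with ⟨x, hx⟩ | ⟨k, hk, hodd⟩
  · refine ⟨{x}, 1, by simp, by simp, ?_, ?_⟩
    · intro q
      simp only [Finset.mem_singleton]
      constructor
      · intro h; exact σ.injective (h.trans hx.symm)
      · rintro rfl; exact hx
    · intro q hq
      rw [Finset.mem_singleton] at hq
      subst hq
      simp [hx]
  · rw [Equiv.Perm.cycleType_def, Multiset.mem_map] at hk
    obtain ⟨c, hc, rfl⟩ := hk
    have hc : c ∈ σ.cycleFactorsFinset := hc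
    have hc2 := (Equiv.Perm.mem_cycleFactorsFinset_iff.1 hc).2
    have hconj : IsConj c c⁻¹ := by
      rw [Equiv.Perm.isConj_iff_cycleType_eq, Equiv.Perm.cycleType_inv]
    obtain ⟨g, hg⟩ := isConj_iff.1 hconj
    have hg' : ∀ q, g (c q) = c⁻¹ (g q) := by
      intro q; rw [← hg]; simp
    have hgs : ∀ q, g q ∈ c.support ↔ q ∈ c.support := by
      intro q
      rw [← Equiv.Perm.support_inv c]
      rw [Equiv.Perm.mem_support, ← hg', Equiv.Perm.support_inv, Equiv.Perm.mem_support]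
      simp
    refine ⟨c.support, g, hodd, hgs, ?_, ?_⟩
    · intro q
      constructor
      · intro h
        have h1 : c⁻¹ (σ q) ∈ c.support := by
          rw [← Equiv.Perm.apply_mem_support]; simpa using h
        have h2 := hc2 _ h1
        rw [← Equiv.Perm.mul_apply, mul_inv_cancel, Equiv.Perm.one_apply] at h2
        rw [← σ.injective h2.symm]; exact h1
      · intro h
        rw [← hc2 q h, Equiv.Perm.apply_mem_support]; exact h
    · intro q hq
      rw [← hc2 q hq, hg', ← hc2 (c⁻¹ (g q))]
      · simp
      · rw [← Equiv.Perm.apply_mem_support]; simpa [-Equiv.Perm.mem_support] using (hgs q).2 hq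

/-- The flip-and-reflect map on the pairs indexed by `C`. -/
def flipMap {n : ℕ} (C : Finset (Fin n)) (g : Equiv.Perm (Fin n)) (x : Fin (n + n)) :
    Fin (n + n) :=
  Sum.elim (fun q => if q ∈ C then highIdx n (g q) else lowIdx n q)
    (fun q => if q ∈ C then lowIdx n (g q) else highIdx n q)
    ((finSumFinEquiv (m := n) (n := n)).symm x)

lemma flip_low {n : ℕ} (C : Finset (Fin n)) (g : Equiv.Perm (Fin n)) (q : Fin n) :
    flipMap C g (lowIdx n q) = if q ∈ C then highIdx n (g q) else lowIdx n q := by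
  rw [flipMap, lowIdx, Equiv.symm_apply_apply]; rfl

lemma flip_high {n : ℕ} (C : Finset (Fin n)) (g : Equiv.Perm (Fin n)) (q : Fin n) :
    flipMap C g (highIdx n q) = if q ∈ C then lowIdx n (g q) else highIdx n q := by
  rw [flipMap, highIdx, Equiv.symm_apply_apply]; rfl

lemma flip_inj {n : ℕ} (C : Finset (Fin n)) (g : Equiv.Perm (Fin n))
    (hg : ∀ q, g q ∈ C ↔ q ∈ C) : Function.Injective (flipMap C g) := by
  intro x y h
  rcases idx_cases n x with ⟨q, rfl⟩ | ⟨q, rfl⟩ <;>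
    rcases idx_cases n y with ⟨r, rfl⟩ | ⟨r, rfl⟩ <;>
    simp only [flip_low, flip_high] at h <;>
    by_cases hq : q ∈ C <;> by_cases hr : r ∈ C <;>
    simp only [hq, hr, if_true, if_false, low_inj, high_inj, low_ne_high, high_ne_low,
      EmbeddingLike.apply_eq_iff_eq] at h
  all_goals first
    | (subst h; rfl)
    | (subst h; exact absurd ((hg _).1 (by assumption)) (by assumption))
    | (subst h; exact absurd ((hg _).2 (by assumption)) (by assumption))

lemma odd_reflect {n : ℕ} (σ : Equiv.Perm (Fin n))
    (hσ : (∃ x, σ x = x) ∨ ∃ k ∈ σ.cycleType, Odd k) :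
    ∃ h ∈ hyperoctahedral n, ∃ k ∈ hyperoctahedral n,
      h * embLow n σ * k = embLow n σ ∧ chiMinus n h = -1 := by
  obtain ⟨C, g, hodd, hg, hs, hgs⟩ := odd_data σ hσ
  let h : Equiv.Perm (Fin (n + n)) := Equiv.ofBijective (flipMap C g)
    (Finite.injective_iff_bijective.1 (flip_inj C g hg))
  have hl : ∀ q, h (lowIdx n q) = if q ∈ C then highIdx n (g q) else lowIdx n q := flip_low C g
  have hh : ∀ q, h (highIdx n q) = if q ∈ C then lowIdx n (g q) else highIdx n q := flip_high C g
  have hgs' : ∀ q ∈ C, σ⁻¹ (g q) = g (σ q) := by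
    intro q hq
    rw [Equiv.Perm.inv_eq_iff_eq, hgs q hq]
  have hH : h ∈ hyperoctahedral n := by
    rw [mem_H]
    intro x
    rcases idx_cases n x with ⟨q, rfl⟩ | ⟨q, rfl⟩ <;> by_cases hq : q ∈ C <;>
      simp [hl, hh, pi_low, pi_high, hq]
  have hk : (embLow n σ)⁻¹ * h * embLow n σ ∈ hyperoctahedral n := by
    rw [mem_H, emb_inv]
    intro x
    rcases idx_cases n x with ⟨q, rfl⟩ | ⟨q, rfl⟩ <;> by_cases hq : q ∈ C <;>
      simp [hl, hh, pi_low, pi_high, hq, emb_low, emb_high, hs, hgs']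
  refine ⟨h, hH, _, H_inv hk, by group, ?_⟩
  rw [chiMinus]
  have : Finset.univ.filter (fun q : Fin n => ∃ r : Fin n, h (lowIdx n q) = highIdx n r) = C := by
    ext q
    by_cases hq : q ∈ C
    · simp [hl, hq, high_inj]
    · simp [hl, hq, low_ne_high]
  rw [this, hodd.neg_one_pow]

/-! ### Double cosets -/

lemma not_sameCycle {α : Type*} (a b : Equiv.Perm α) (ha : a * a = 1) (hb : b * b = 1)
    (ha' : ∀ x, a x ≠ x) (hb' : ∀ x, b x ≠ x) (x : α) : ¬ (a * b).SameCycle x (a x) := by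
  have hai : a⁻¹ = a := inv_eq_of_mul_eq_one_left ha
  have hbi : b⁻¹ = b := inv_eq_of_mul_eq_one_left hb
  have hconj : ∀ i : ℤ, a * (a * b) ^ i = (a * b) ^ (-i) * a := by
    intro i
    have h1 : a * (a * b) * a⁻¹ = (a * b)⁻¹ := by
      rw [mul_inv_rev, hai, hbi, ← mul_assoc, ha, one_mul]
    have h2 : a * (a * b) ^ i * a⁻¹ = (a * b) ^ (-i) := by
      rw [← conj_zpow, h1, inv_zpow']
    rw [← h2]; group
  rintro ⟨j, hj⟩
  obtain ⟨i, rfl | rfl⟩ := Int.even_or_odd' j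
  · apply ha' (((a * b) ^ i) x)
    have := congrFun (congrArg DFunLike.coe (hconj i)) x
    simp only [Equiv.Perm.mul_apply] at this
    rw [this, ← hj, ← Equiv.Perm.mul_apply, ← zpow_add]
    congr 2; ring
  · apply hb' (((a * b) ^ i) x)
    have := congrFun (congrArg DFunLike.coe (hconj i)) x
    simp only [Equiv.Perm.mul_apply] at this
    rw [← hj, ← Equiv.Perm.mul_apply ((a * b) ^ (-i)), ← zpow_add] at this
    have h3 : b * (a * b) ^ i = a * (a * b) ^ (-i + (2 * i + 1)) := by
      rw [show -i + (2 * i + 1) = 1 + i by ring, zpow_add, zpow_one, ← mul_assoc, ← mul_assoc, ha,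
        one_mul]
    have h4 := congrFun (congrArg DFunLike.coe h3) x
    simp only [Equiv.Perm.mul_apply] at h4
    rw [h4, ← this, ← Equiv.Perm.mul_apply, ha]; rfl

lemma exists_coloring {α : Type*} [LinearOrder α] (a b : Equiv.Perm α) (ha : a * a = 1)
    (hb : b * b = 1) (ha' : ∀ x, a x ≠ x) (hb' : ∀ x, b x ≠ x) :
    ∃ s : α → Prop, (∀ x, s (a x) ↔ ¬ s x) ∧ (∀ x, s (b x) ↔ ¬ s x) := by
  let m : α → α := fun x => (Quotient.mk (Equiv.Perm.SameCycle.setoid (a * b)) x).out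
  have hm : ∀ x y, m x = m y ↔ (a * b).SameCycle x y := by
    intro x y
    rw [Quotient.out_inj, Quotient.eq]; rfl
  have haa : ∀ x, a (a x) = x := fun x => by rw [← Equiv.Perm.mul_apply, ha]; rfl
  have hbb : ∀ x, b (b x) = x := fun x => by rw [← Equiv.Perm.mul_apply, hb]; rfl
  have hne : ∀ x, m x ≠ m (a x) := fun x h =>
    not_sameCycle a b ha hb ha' hb' x ((hm _ _).1 h)
  have h1 : ∀ x, m (a (b x)) = m x := fun x => ((hm _ _).2 ⟨1, by simp⟩).symm
  have h2 : ∀ x, m (b x) = m (a x) := fun x => by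
    have := h1 (b x)
    rw [hbb] at this
    exact this.symm
  have key : ∀ x, m (a x) < m x ↔ ¬ m x < m (a x) := by
    intro x
    rw [not_lt]
    exact ⟨le_of_lt, fun h => lt_of_le_of_ne h (hne x).symm⟩
  refine ⟨fun x => m x < m (a x), fun x => ?_, fun x => ?_⟩
  · show m (a x) < m (a (a x)) ↔ _
    rw [haa, key]
  · show m (b x) < m (a (b x)) ↔ _
    rw [h1, h2, key]

open Classical in
/-- Given a colouring, an element of the hyperoctahedral group moving the upper half to `s`. -/
noncomputable def colMap {n : ℕ} (s : Fin (n + n) → Prop) (x : Fin (n + n)) : Fin (n + n) :=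
  if s (highIdx n (pairIdx n x)) then x else pairInvolution n x

lemma pairIdx_pi {n : ℕ} (x : Fin (n + n)) : pairIdx n (pairInvolution n x) = pairIdx n x := by
  rcases idx_cases n x with ⟨q, rfl⟩ | ⟨q, rfl⟩ <;>
    simp only [pi_low, pi_high, pairIdx_low, pairIdx_high]

lemma exists_col {n : ℕ} (s : Fin (n + n) → Prop) (hs : ∀ x, s (pairInvolution n x) ↔ ¬ s x) :
    ∃ h ∈ hyperoctahedral n, (∀ q, s (h (highIdx n q))) ∧ (∀ q, ¬ s (h (lowIdx n q))) := by
  have hinv : Function.Involutive (colMap s) := by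
    intro x
    by_cases h : s (highIdx n (pairIdx n x)) <;> simp [colMap, h, pairIdx_pi, pi_pi]
  have hH : Function.Involutive.toPerm _ hinv ∈ hyperoctahedral n := by
    rw [mem_H]
    intro x
    by_cases h : s (highIdx n (pairIdx n x)) <;> simp [colMap, h, pairIdx_pi, pi_pi]
  have h1 : ∀ q, s ((Function.Involutive.toPerm _ hinv) (highIdx n q)) := by
    intro q
    by_cases h : s (highIdx n q) <;> simp [colMap, h, pairIdx_high, hs]
  refine ⟨Function.Involutive.toPerm _ hinv, hH, h1, ?_⟩
  intro q
  rw [← pi_high, mem_H.1 hH, hs, not_not]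
  exact h1 q

/-- The diagonal embedding of `S_n`. -/
def diagEmb (n : ℕ) (β : Equiv.Perm (Fin n)) : Equiv.Perm (Fin (n + n)) :=
  finSumFinEquiv.permCongr (Equiv.sumCongr β β)

lemma diag_low {n : ℕ} (σ : Equiv.Perm (Fin n)) (q : Fin n) :
    diagEmb n σ (lowIdx n q) = lowIdx n (σ q) := by
  simp only [diagEmb, lowIdx, Equiv.permCongr_apply, Equiv.symm_apply_apply, Equiv.sumCongr_apply,
    Sum.map_inl]

lemma diag_high {n : ℕ} (σ : Equiv.Perm (Fin n)) (q : Fin n) :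
    diagEmb n σ (highIdx n q) = highIdx n (σ q) := by
  simp only [diagEmb, highIdx, Equiv.permCongr_apply, Equiv.symm_apply_apply,
    Equiv.sumCongr_apply, Sum.map_inr]

lemma diag_mem {n : ℕ} (σ : Equiv.Perm (Fin n)) : diagEmb n σ ∈ hyperoctahedral n := by
  rw [mem_H]
  intro x
  rcases idx_cases n x with ⟨q, rfl⟩ | ⟨q, rfl⟩ <;>
    simp only [pi_low, pi_high, diag_low, diag_high]

lemma double_coset {n : ℕ} (τ : Equiv.Perm (Fin (n + n))) : ∃ σ₀ : Equiv.Perm (Fin n),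
      ∃ h₁ ∈ hyperoctahedral n, ∃ h₂ ∈ hyperoctahedral n,
        τ = h₁ * embLow n σ₀ * h₂ := by
  have hpp : pairInvolution n * pairInvolution n = 1 := by
    ext1 x; exact pi_pi x
  obtain ⟨s, hs1, hs2⟩ := exists_coloring (pairInvolution n) (τ * pairInvolution n * τ⁻¹) hpp
    (by
      have : τ * pairInvolution n * τ⁻¹ * (τ * pairInvolution n * τ⁻¹) =
        τ * (pairInvolution n * pairInvolution n) * τ⁻¹ := by group
      rw [this, hpp]; group)
    pi_ne
    (by
      intro x h
      simp only [Equiv.Perm.mul_apply] at h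
      rw [← Equiv.Perm.eq_inv_iff_eq] at h
      exact pi_ne _ h)
  obtain ⟨h, hH, hh, hl⟩ := exists_col s hs1
  obtain ⟨k, kH, kh, kl⟩ := exists_col (fun x => s (τ x)) (by
    intro x
    have := hs2 (τ x)
    simpa using this)
  have e1 : ∀ q, ∃ r, (h⁻¹ * τ * k) (highIdx n q) = highIdx n r := by
    intro q
    rcases idx_cases n ((h⁻¹ * τ * k) (highIdx n q)) with ⟨r, hr⟩ | ⟨r, hr⟩
    · exfalso
      apply hl r
      rw [← hr]
      simpa using kh q
    · exact ⟨r, hr⟩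
  have e2 : ∀ q, ∃ r, (h⁻¹ * τ * k) (lowIdx n q) = lowIdx n r := by
    intro q
    rcases idx_cases n ((h⁻¹ * τ * k) (lowIdx n q)) with ⟨r, hr⟩ | ⟨r, hr⟩
    · exact ⟨r, hr⟩
    · exfalso
      apply kl q
      have := hh r
      rw [← hr] at this
      simpa using this
  choose β hβ using e1
  choose α hα using e2
  have hβi : Function.Injective β := by
    intro p q hpq
    have : (h⁻¹ * τ * k) (highIdx n p) = (h⁻¹ * τ * k) (highIdx n q) := by rw [hβ, hβ, hpq]
    exact high_inj.1 ((h⁻¹ * τ * k).injective this)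
  have hαi : Function.Injective α := by
    intro p q hpq
    have : (h⁻¹ * τ * k) (lowIdx n p) = (h⁻¹ * τ * k) (lowIdx n q) := by rw [hα, hα, hpq]
    exact low_inj.1 ((h⁻¹ * τ * k).injective this)
  let A : Equiv.Perm (Fin n) := Equiv.ofBijective α (Finite.injective_iff_bijective.1 hαi)
  let B : Equiv.Perm (Fin n) := Equiv.ofBijective β (Finite.injective_iff_bijective.1 hβi)
  have key : h⁻¹ * τ * k = embLow n (A * B⁻¹) * diagEmb n B := by
    ext1 x
    rcases idx_cases n x with ⟨q, rfl⟩ | ⟨q, rfl⟩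
    · rw [hα, Equiv.Perm.mul_apply, diag_low, emb_low]
      simp [A]
    · rw [hβ, Equiv.Perm.mul_apply, diag_high, emb_high]
      rfl
  refine ⟨A * B⁻¹, h, hH, diagEmb n B * k⁻¹, H_mul (diag_mem B) (H_inv kH), ?_⟩
  rw [mul_assoc, ← mul_assoc (embLow n _), ← key]
  group

/-! ### The bi-equivariant function -/

/-- The involution on the index set of eigenvalues. -/
def barIdx {M : ℕ} (u : Fin M × Bool) : Fin M × Bool := (u.1, !u.2)

/-- The eigenvalues `± x_i`. -/
noncomputable def eigVal {M : ℕ} (u : Fin M × Bool) : MvPolynomial (Fin M) ℂ :=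
  if u.2 then MvPolynomial.X u.1 else - MvPolynomial.X u.1

lemma bar_bar {M : ℕ} (u : Fin M × Bool) : barIdx (barIdx u) = u := by
  simp [barIdx]

lemma eig_bar {M : ℕ} (u : Fin M × Bool) : eigVal (barIdx u) = - eigVal u := by
  rcases u with ⟨i, _ | _⟩ <;> simp [barIdx, eigVal]

open Classical in
/-- Contraction of antisymmetric and symmetric tensors along a permutation. -/
noncomputable def contr (n M : ℕ) (τ : Equiv.Perm (Fin (n + n))) : MvPolynomial (Fin M) ℂ :=
  ∑ a ∈ Finset.univ.filter (fun a : Fin (n + n) → Fin M × Bool =>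
    (∀ x, a (pairInvolution n x) = barIdx (a x)) ∧
    (∀ x, a (τ (pairInvolution n x)) = barIdx (a (τ x)))),
    ∏ q : Fin n, eigVal (a (lowIdx n q))

lemma contr_equiv {n M : ℕ} {h k : Equiv.Perm (Fin (n + n))} (hh : h ∈ hyperoctahedral n)
    (hk : k ∈ hyperoctahedral n) (τ : Equiv.Perm (Fin (n + n))) :
    contr n M (h * τ * k) = chiMinus n h • contr n M τ := by
  classical
  have hh' := mem_H.1 hh
  have hhi := mem_H.1 (H_inv hh)
  have hk' := mem_H.1 hk
  have hki := mem_H.1 (H_inv hk)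
  unfold contr
  rw [Finset.smul_sum]
  refine Finset.sum_bij' (fun a _ => fun x => a (h x)) (fun a _ => fun x => a (h⁻¹ x)) ?_ ?_ ?_ ?_ ?_
  · intro a ha
    rw [Finset.mem_filter] at ha ⊢
    replace ha := ha.2
    refine ⟨Finset.mem_univ _, ?_⟩
    simp only [Equiv.Perm.mul_apply] at ha ⊢
    refine ⟨fun x => by rw [hh', ha.1], fun x => ?_⟩
    have := ha.2 (k⁻¹ x)
    rw [hk'] at this
    simpa using this
  · intro a ha
    rw [Finset.mem_filter] at ha ⊢
    replace ha := ha.2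
    refine ⟨Finset.mem_univ _, ?_⟩
    simp only [Equiv.Perm.mul_apply] at ha ⊢
    refine ⟨fun x => by rw [hhi, ha.1], fun x => ?_⟩
    have := ha.2 (k x)
    rw [hk']
    simpa using this
  · intro a _
    funext x; simp
  · intro a _
    funext x; simp
  · intro a ha
    simp only [Finset.mem_filter, Finset.mem_univ, true_and] at ha
    have := prod_H (fun x => eigVal (a x)) (fun x => by rw [ha.1, eig_bar]) hh
    rw [this, chiMinus, Algebra.smul_def, ← mul_assoc, map_pow, map_neg, map_one, ← mul_pow]
    simp

lemma contr_emb {n M : ℕ} (σ : Equiv.Perm (Fin n)) (hσ : ∀ x, σ x ≠ x) :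
    contr n M (embLow n σ) =
      (σ.cycleType.map (fun k => ∑ u : Fin M × Bool, eigVal u ^ k)).prod := by
  classical
  rw [← sum_invariant σ hσ]
  unfold contr
  refine Finset.sum_bij' (fun a _ => fun q => a (lowIdx n q))
    (fun b _ => fun x => Sum.elim b (fun q => barIdx (b q))
      ((finSumFinEquiv (m := n) (n := n)).symm x)) ?_ ?_ ?_ ?_ ?_
  · intro a ha
    simp only [Finset.mem_filter, Finset.mem_univ, true_and] at ha ⊢
    intro q
    have h1 := ha.2 (lowIdx n q)
    rw [pi_low, emb_high, emb_low, ← pi_low, ha.1] at h1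
    rw [← bar_bar (a (lowIdx n (σ q))), ← h1, bar_bar]
  · intro b hb
    simp only [Finset.mem_filter, Finset.mem_univ, true_and] at hb ⊢
    have hL : ∀ q, Sum.elim b (fun q => barIdx (b q))
      ((finSumFinEquiv (m := n) (n := n)).symm (lowIdx n q)) = b q := fun q => by
        rw [lowIdx, Equiv.symm_apply_apply]; rfl
    have hR : ∀ q, Sum.elim b (fun q => barIdx (b q))
      ((finSumFinEquiv (m := n) (n := n)).symm (highIdx n q)) = barIdx (b q) := fun q => by
        rw [highIdx, Equiv.symm_apply_apply]; rfl
    constructor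
    · intro x
      rcases idx_cases n x with ⟨q, rfl⟩ | ⟨q, rfl⟩ <;>
        simp only [pi_low, pi_high, hL, hR, bar_bar]
    · intro x
      rcases idx_cases n x with ⟨q, rfl⟩ | ⟨q, rfl⟩ <;>
        simp only [pi_low, pi_high, emb_low, emb_high, hL, hR, bar_bar, hb]
  · intro a ha
    simp only [Finset.mem_filter, Finset.mem_univ, true_and] at ha
    funext x
    rcases idx_cases n x with ⟨q, rfl⟩ | ⟨q, rfl⟩
    · show Sum.elim _ _ ((finSumFinEquiv (m := n) (n := n)).symm (lowIdx n q)) = _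
      rw [lowIdx, Equiv.symm_apply_apply]; rfl
    · show Sum.elim _ _ ((finSumFinEquiv (m := n) (n := n)).symm (highIdx n q)) = _
      rw [← pi_low, ha.1, pi_low, highIdx, Equiv.symm_apply_apply]; rfl
  · intro b _
    funext q
    show Sum.elim _ _ ((finSumFinEquiv (m := n) (n := n)).symm (lowIdx n q)) = _
    rw [lowIdx, Equiv.symm_apply_apply]; rfl
  · intro a _
    rfl

lemma contr_val {n M : ℕ} (σ : Equiv.Perm (Fin n)) (ρ : Multiset ℕ) (hσ : ∀ x, σ x ≠ x)
    (hρ : σ.cycleType = ρ.map (fun k => 2 * k)) :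
    contr n M (embLow n σ) = (2 ^ Multiset.card ρ : ℂ) • powerSumSq M ρ := by
  rw [contr_emb σ hσ, hρ, Multiset.map_map, powerSumSq]
  have : ∀ k : ℕ, ∑ u : Fin M × Bool, (eigVal u) ^ (2 * k) =
      2 * ∑ i : Fin M, (MvPolynomial.X i : MvPolynomial (Fin M) ℂ) ^ (2 * k) := by
    intro k
    rw [Fintype.sum_prod_type, Finset.mul_sum]
    refine Finset.sum_congr rfl fun i _ => ?_
    simp [eigVal, pow_mul, two_mul]
  simp only [Function.comp_def, this, Multiset.prod_map_mul, Multiset.map_const',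
    Multiset.prod_replicate]
  rw [Algebra.smul_def, map_pow, map_ofNat]

lemma dichotomy {n : ℕ} (σ : Equiv.Perm (Fin n)) :
    (∃ ρ : Multiset ℕ, (∀ x, σ x ≠ x) ∧ σ.cycleType = ρ.map (fun k => 2 * k)) ∨
      ((∃ x, σ x = x) ∨ ∃ k ∈ σ.cycleType, Odd k) := by
  by_cases h : (∃ x, σ x = x) ∨ ∃ k ∈ σ.cycleType, Odd k
  · exact Or.inr h
  · left
    push Not at h
    refine ⟨σ.cycleType.map (fun k => k / 2), h.1, ?_⟩
    rw [Multiset.map_map]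
    symm
    conv_rhs => rw [← Multiset.map_id σ.cycleType]
    refine Multiset.map_congr rfl fun k hk => ?_
    have := h.2 k hk
    rw [Nat.not_odd_iff_even] at this
    exact Nat.two_mul_div_two_of_even this

lemma hPlus_eq (n : ℕ) : hPlus n =
    avg (hyperoctahedral n) (fun _ => 1) ((n.factorial : ℂ) * 2 ^ n)⁻¹ := by
  simp only [hPlus, avg, one_smul]

lemma hMinus_eq (n : ℕ) : hMinus n =
    avg (hyperoctahedral n) (chiMinus n) ((n.factorial : ℂ) * 2 ^ n)⁻¹ := rfl

lemma sandwichMP_eq (n : ℕ) (y : MonoidAlgebra ℂ (Equiv.Perm (Fin (n + n)))) :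
    sandwichMP n y =
      avg (hyperoctahedral n) (chiMinus n) ((n.factorial : ℂ) * 2 ^ n)⁻¹ * y *
      avg (hyperoctahedral n) (fun _ => 1) ((n.factorial : ℂ) * 2 ^ n)⁻¹ := by
  rw [← hPlus_eq, ← hMinus_eq, mul_assoc]; rfl

lemma sandwichPM_eq (n : ℕ) (y : MonoidAlgebra ℂ (Equiv.Perm (Fin (n + n)))) :
    sandwichPM n y =
      avg (hyperoctahedral n) (fun _ => 1) ((n.factorial : ℂ) * 2 ^ n)⁻¹ * y *
      avg (hyperoctahedral n) (chiMinus n) ((n.factorial : ℂ) * 2 ^ n)⁻¹ := by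
  rw [← hPlus_eq, ← hMinus_eq, mul_assoc]; rfl

lemma odd_zero {n : ℕ} (σ : Equiv.Perm (Fin n))
    (hσ : (∃ x, σ x = x) ∨ ∃ k ∈ σ.cycleType, Odd k) :
    sandwichMP n (MonoidAlgebra.of ℂ _ (embLow n σ)) = 0 ∧
      sandwichPM n (MonoidAlgebra.of ℂ _ (embLow n σ)) = 0 := by
  constructor
  · obtain ⟨h, hh, k, hk, e, hc⟩ := odd_reflect σ hσ
    rw [sandwichMP_eq]
    exact sandwich_zero _ _ _ (fun h hh k hk => H_mul hh hk) (fun h hh => H_inv hh)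
      (fun h hh k hk => chi_mul hh hk) (fun h _ => chi_sq h) (by simp) (by simp) _ hh hk _ e
      (by rw [hc, mul_one])
  · obtain ⟨h, hh, k, hk, e, hc⟩ := odd_reflect σ⁻¹ (by
      rcases hσ with ⟨x, hx⟩ | h
      · exact Or.inl ⟨x, by rw [Equiv.Perm.inv_eq_iff_eq, hx]⟩
      · exact Or.inr (by rwa [Equiv.Perm.cycleType_inv]))
    rw [sandwichPM_eq]
    refine sandwich_zero _ _ _ (fun h hh k hk => H_mul hh hk) (fun h hh => H_inv hh)
      (by simp) (by simp) (fun h hh k hk => chi_mul hh hk) (fun h _ => chi_sq h) _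
      (H_inv hk) (H_inv hh) _ ?_ (by rw [chi_inv hh, hc, one_mul])
    rw [← emb_inv] at e
    have := congrArg (fun g => g⁻¹) e
    simpa [mul_assoc] using this

/-- **Well-definedness of the characteristic maps** (Proposition 3.1):
(i) every double coset of `H_n` in `S_{2n}` contains a permutation acting trivially
on `n+1,…,2n`; (ii) `h₋ σ h₊ = h₊ σ h₋ = 0` whenever the permutation `σ` of `{1,…,n}`
has an odd cycle (including fixed points); (iii) there are unique linear maps
`ch : h∓(ℂ·S_{2n})h± → Λ_M` with `ch(h∓ σ h±) = 2^{ℓ(ρ)} p_ρ(x_1²,…,x_M²)` for every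
permutation `σ` of `{1,…,n}` with cycle lengths `2ρ_1, 2ρ_2, …`. -/
theorem characteristic_maps_well_defined (n M : ℕ) :
    (∀ τ : Equiv.Perm (Fin (n + n)), ∃ σ₀ : Equiv.Perm (Fin n),
      ∃ h₁ ∈ hyperoctahedral n, ∃ h₂ ∈ hyperoctahedral n,
        τ = h₁ * embLow n σ₀ * h₂) ∧
    (∀ σ₀ : Equiv.Perm (Fin n),
      ((∃ x, σ₀ x = x) ∨ ∃ k ∈ σ₀.cycleType, Odd k) →
      sandwichMP n (MonoidAlgebra.of ℂ _ (embLow n σ₀)) = 0 ∧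
      sandwichPM n (MonoidAlgebra.of ℂ _ (embLow n σ₀)) = 0) ∧
    (∃! ch : ↥(LinearMap.range (sandwichMP n)) →ₗ[ℂ] MvPolynomial (Fin M) ℂ,
      ∀ (σ₀ : Equiv.Perm (Fin n)) (ρ : Multiset ℕ),
        (∀ x, σ₀ x ≠ x) → σ₀.cycleType = ρ.map (fun k => 2 * k) →
        ch ⟨sandwichMP n (MonoidAlgebra.of ℂ _ (embLow n σ₀)),
            LinearMap.mem_range_self _ _⟩ =
          (2 ^ Multiset.card ρ : ℂ) • powerSumSq M ρ) ∧
    (∃! ch : ↥(LinearMap.range (sandwichPM n)) →ₗ[ℂ] MvPolynomial (Fin M) ℂ,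
      ∀ (σ₀ : Equiv.Perm (Fin n)) (ρ : Multiset ℕ),
        (∀ x, σ₀ x ≠ x) → σ₀.cycleType = ρ.map (fun k => 2 * k) →
        ch ⟨sandwichPM n (MonoidAlgebra.of ℂ _ (embLow n σ₀)),
            LinearMap.mem_range_self _ _⟩ =
          (2 ^ Multiset.card ρ : ℂ) • powerSumSq M ρ) := by
  have hc : ((n.factorial : ℂ) * 2 ^ n)⁻¹ ≠ 0 := by
    have : (n.factorial : ℂ) ≠ 0 := by exact_mod_cast n.factorial_ne_zero
    simp [this]
  refine ⟨fun τ => double_coset τ, fun σ₀ h => odd_zero σ₀ h, ?_, ?_⟩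
  · have key := exists_unique_ch (hyperoctahedral n) (chiMinus n) (fun _ => 1) H_one
      (fun h hh k hk => H_mul hh hk) (fun h hh => H_inv hh)
      (fun h hh k hk => chi_mul hh hk) (fun h _ => chi_sq h) (by simp) (by simp) _ hc
      (sandwichMP n) (sandwichMP_eq n) (embLow n)
      (fun (σ₀ : Equiv.Perm (Fin n)) (ρ : Multiset ℕ) =>
        (∀ x, σ₀ x ≠ x) ∧ σ₀.cycleType = ρ.map (fun k => 2 * k))
      (fun ρ => (2 ^ Multiset.card ρ : ℂ) • powerSumSq M ρ) double_coset
      (contr n M) (fun h hh k hk t => by rw [contr_equiv hh hk, mul_one])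
      (fun s ρ h => contr_val s ρ h.1 h.2)
      (fun s => (dichotomy s).imp id (fun h => (odd_zero s h).1))
    simpa only [and_imp] using key
  · have key := exists_unique_ch (hyperoctahedral n) (fun _ => 1) (chiMinus n) H_one
      (fun h hh k hk => H_mul hh hk) (fun h hh => H_inv hh)
      (by simp) (by simp) (fun h hh k hk => chi_mul hh hk) (fun h _ => chi_sq h) _ hc
      (sandwichPM n) (sandwichPM_eq n) (embLow n)
      (fun (σ₀ : Equiv.Perm (Fin n)) (ρ : Multiset ℕ) =>
        (∀ x, σ₀ x ≠ x) ∧ σ₀.cycleType = ρ.map (fun k => 2 * k))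
      (fun ρ => (2 ^ Multiset.card ρ : ℂ) • powerSumSq M ρ) double_coset
      (fun t => contr n M t⁻¹) (fun h hh k hk t => by
        rw [mul_inv_rev, mul_inv_rev, ← mul_assoc, contr_equiv (H_inv hk) (H_inv hh),
          chi_inv hk, one_mul])
      (fun s ρ h => by
        rw [emb_inv]
        refine contr_val s⁻¹ ρ (fun x hx => h.1 x ?_) ?_
        · rw [Equiv.Perm.inv_eq_iff_eq] at hx
          exact hx.symm
        · rw [Equiv.Perm.cycleType_inv, h.2])
      (fun s => (dichotomy s).imp id (fun h => (odd_zero s h).2))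
    simpa only [and_imp] using key
end

section
/- The irreducible S_{2n}-module W_ω contains a nonzero vector w_+ with σ·w_+ = χ_+(σ) w_+ for all σ in the hyperoctahedral subgroup H_n if and only if every row of the Young diagram of ω has even length; and W_ω contains a nonzero vector w_- with σ·w_- = χ_-(σ) w_- for all σ ∈ H_n if and only if every column of ω has even length. In each case such a vector is unique up to scalar. -/
open MonoidAlgebra

/-- The Young symmetrizer (column antisymmetrizer times row symmetrizer) of a
bijective filling `f` of a Young diagram by `1,…,m`. -/
noncomputable def youngSymmetrizer (m : ℕ) (f : Fin m → ℕ × ℕ) :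
    MonoidAlgebra ℂ (Equiv.Perm (Fin m)) :=
  (∑ σ ∈ Finset.univ.filter (fun σ : Equiv.Perm (Fin m) =>
      ∀ p, (f (σ p)).2 = (f p).2),
    ((Equiv.Perm.sign σ : ℤ) : ℂ) • MonoidAlgebra.of ℂ (Equiv.Perm (Fin m)) σ) *
  (∑ σ ∈ Finset.univ.filter (fun σ : Equiv.Perm (Fin m) =>
      ∀ p, (f (σ p)).1 = (f p).1),
    MonoidAlgebra.of ℂ (Equiv.Perm (Fin m)) σ)

/-- The irreducible module `W_ω`, realized as the left ideal `ℂ·S_m · e_f` generated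
by the Young symmetrizer of a bijective filling `f` of the diagram `ω`. -/
noncomputable def spechtIdeal (m : ℕ) (f : Fin m → ℕ × ℕ) :
    Submodule ℂ (MonoidAlgebra ℂ (Equiv.Perm (Fin m))) :=
  LinearMap.range (LinearMap.mulRight ℂ (youngSymmetrizer m f))


namespace HypOct

/-- Linear functional on the group algebra given by a function on the group. -/
noncomputable def Lf {G : Type*} [Fintype G] (φ : G → ℂ) : MonoidAlgebra ℂ G →ₗ[ℂ] ℂ where
  toFun w := ∑ σ, w.coeff σ * φ σ
  map_add' x y := by simp [add_mul, Finset.sum_add_distrib]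
  map_smul' c x := by simp [Finset.mul_sum, mul_assoc]

theorem Lf_apply {G : Type*} [Fintype G] (φ : G → ℂ) (w : MonoidAlgebra ℂ G) :
    Lf φ w = ∑ σ, w.coeff σ * φ σ := rfl

theorem Lf_mul_of {G : Type*} [Fintype G] [Group G] (φ : G → ℂ) (w : MonoidAlgebra ℂ G) (g : G) :
    Lf φ (w * MonoidAlgebra.of ℂ G g) = Lf (fun σ => φ (σ * g)) w := by
  simp only [Lf_apply, MonoidAlgebra.of_apply, MonoidAlgebra.coeff_mul_single_apply, mul_one]
  exact Fintype.sum_equiv (Equiv.mulRight g⁻¹) _ _ (fun σ => by simp)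

theorem Lf_of_mul {G : Type*} [Fintype G] [Group G] (φ : G → ℂ) (w : MonoidAlgebra ℂ G) (g : G) :
    Lf φ (MonoidAlgebra.of ℂ G g * w) = Lf (fun σ => φ (g * σ)) w := by
  simp only [Lf_apply, MonoidAlgebra.of_apply, MonoidAlgebra.coeff_single_mul_apply, one_mul]
  exact Fintype.sum_equiv (Equiv.mulLeft g⁻¹) _ _ (fun σ => by simp)

theorem Lf_of {G : Type*} [Fintype G] [Group G] (φ : G → ℂ) (g : G) :
    Lf φ (MonoidAlgebra.of ℂ G g) = φ g := by
  classical
  simp [Lf_apply, MonoidAlgebra.coeff_single, Finsupp.single_apply]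

/-- Hermitian form. -/
noncomputable def ip {G : Type*} [Fintype G] (u v : MonoidAlgebra ℂ G) : ℂ :=
  Lf (fun σ => (starRingEnd ℂ) (v.coeff σ)) u

theorem ip_self {G : Type*} [Fintype G] (u : MonoidAlgebra ℂ G) (h : ip u u = 0) : u = 0 := by
  have h1 : ((∑ σ, Complex.normSq (u.coeff σ) : ℝ) : ℂ) = 0 := by
    rw [← h, ip, Lf_apply]
    push_cast
    exact Finset.sum_congr rfl fun σ _ => (Complex.mul_conj _).symm
  have h2 : (∑ σ, Complex.normSq (u.coeff σ) : ℝ) = 0 := by exact_mod_cast h1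
  rw [Finset.sum_eq_zero_iff_of_nonneg (fun _ _ => Complex.normSq_nonneg _)] at h2
  apply MonoidAlgebra.ext
  ext σ
  simpa using h2 σ (Finset.mem_univ _)

theorem ip_mul_of {G : Type*} [Fintype G] [Group G] (u v : MonoidAlgebra ℂ G) (g : G) :
    ip (u * MonoidAlgebra.of ℂ G g) v = ip u (v * MonoidAlgebra.of ℂ G g⁻¹) := by
  rw [ip, Lf_mul_of, ip]
  simp

theorem ip_smul_right {G : Type*} [Fintype G] (c : ℂ) (u v : MonoidAlgebra ℂ G) :
    ip u (c • v) = (starRingEnd ℂ c) * ip u v := by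
  simp only [ip, Lf_apply, Finset.mul_sum]
  refine Finset.sum_congr rfl fun σ _ => ?_
  simp; ring

theorem ip_sum_right {G ι : Type*} [Fintype G] (s : Finset ι) (u : MonoidAlgebra ℂ G)
    (v : ι → MonoidAlgebra ℂ G) :
    ip u (∑ i ∈ s, v i) = ∑ i ∈ s, ip u (v i) := by
  simp only [ip, Lf_apply]
  rw [Finset.sum_comm]
  refine Finset.sum_congr rfl fun σ _ => ?_
  simp [Finset.mul_sum]

theorem ip_sum_left {G ι : Type*} [Fintype G] (s : Finset ι) (v : MonoidAlgebra ℂ G)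
    (u : ι → MonoidAlgebra ℂ G) :
    ip (∑ i ∈ s, u i) v = ∑ i ∈ s, ip (u i) v := by
  simp only [ip, map_sum]

theorem ip_smul_left {G : Type*} [Fintype G] (c : ℂ) (u v : MonoidAlgebra ℂ G) :
    ip (c • u) v = c * ip u v := by
  simp [ip]

/-- The stabilizer of a labelling. -/
def stab {m : ℕ} (r : Fin m → ℕ) : Finset (Equiv.Perm (Fin m)) :=
  Finset.univ.filter (fun σ => ∀ p, r (σ p) = r p)

theorem mem_stab {m : ℕ} {r : Fin m → ℕ} {σ : Equiv.Perm (Fin m)} :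
    σ ∈ stab r ↔ ∀ p, r (σ p) = r p := by simp [stab]

theorem inv_mem_stab {m : ℕ} {r : Fin m → ℕ} {σ : Equiv.Perm (Fin m)} (h : σ ∈ stab r) :
    σ⁻¹ ∈ stab r := by
  rw [mem_stab] at *
  intro p
  have := h (σ⁻¹ p)
  simpa using this.symm

theorem mul_mem_stab {m : ℕ} {r : Fin m → ℕ} {σ τ : Equiv.Perm (Fin m)} (h : σ ∈ stab r)
    (h' : τ ∈ stab r) : σ * τ ∈ stab r := by
  rw [mem_stab] at *
  intro p
  simp [h, h']

theorem one_mem_stab {m : ℕ} {r : Fin m → ℕ} : (1 : Equiv.Perm (Fin m)) ∈ stab r := by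
  simp [mem_stab]

/-- Symmetrizer. -/
noncomputable def RS {m : ℕ} (r : Fin m → ℕ) : MonoidAlgebra ℂ (Equiv.Perm (Fin m)) :=
  ∑ σ ∈ stab r, MonoidAlgebra.of ℂ (Equiv.Perm (Fin m)) σ

/-- The sign as a complex number. -/
noncomputable def sg {m : ℕ} (σ : Equiv.Perm (Fin m)) : ℂ := ((Equiv.Perm.sign σ : ℤ) : ℂ)

theorem sg_mul {m : ℕ} (σ τ : Equiv.Perm (Fin m)) : sg (σ * τ) = sg σ * sg τ := by
  simp [sg]

theorem sg_inv {m : ℕ} (σ : Equiv.Perm (Fin m)) : sg σ⁻¹ = sg σ := by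
  simp [sg]

theorem sg_sq {m : ℕ} (σ : Equiv.Perm (Fin m)) : sg σ * sg σ = 1 := by
  rw [sg, ← Int.cast_mul]
  rcases Int.units_eq_one_or (Equiv.Perm.sign σ) with h | h <;> simp [h]

theorem sg_conj {m : ℕ} (σ : Equiv.Perm (Fin m)) : (starRingEnd ℂ) (sg σ) = sg σ := by
  simp [sg]

/-- Antisymmetrizer. -/
noncomputable def CS {m : ℕ} (r : Fin m → ℕ) : MonoidAlgebra ℂ (Equiv.Perm (Fin m)) :=
  ∑ σ ∈ stab r, sg σ • MonoidAlgebra.of ℂ (Equiv.Perm (Fin m)) σ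

theorem young_eq {m : ℕ} (f : Fin m → ℕ × ℕ) :
    youngSymmetrizer m f = CS (fun p => (f p).2) * RS (fun p => (f p).1) := rfl

theorem sum_stab_mul {m : ℕ} {M : Type*} [AddCommMonoid M] {r : Fin m → ℕ}
    {t : Equiv.Perm (Fin m)} (ht : t ∈ stab r) (F : Equiv.Perm (Fin m) → M) :
    ∑ σ ∈ stab r, F (σ * t) = ∑ σ ∈ stab r, F σ := by
  refine Finset.sum_equiv (Equiv.mulRight t) (fun σ => ?_) (fun σ _ => rfl)
  simp only [Equiv.coe_mulRight]
  refine ⟨fun h => mul_mem_stab h ht, fun h => ?_⟩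
  have := mul_mem_stab h (inv_mem_stab ht)
  simpa using this

theorem sum_stab_inv {m : ℕ} {M : Type*} [AddCommMonoid M] {r : Fin m → ℕ}
    (F : Equiv.Perm (Fin m) → M) :
    ∑ σ ∈ stab r, F (σ⁻¹) = ∑ σ ∈ stab r, F σ := by
  refine Finset.sum_equiv (Equiv.inv _) (fun σ => ?_) (fun σ _ => rfl)
  simp only [Equiv.inv_apply]
  refine ⟨fun h => inv_mem_stab h, fun h => ?_⟩
  have := inv_mem_stab h
  simpa using this

theorem RS_mul_of {m : ℕ} {r : Fin m → ℕ} {t : Equiv.Perm (Fin m)} (ht : t ∈ stab r) :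
    RS r * MonoidAlgebra.of ℂ _ t = RS r := by
  rw [RS, Finset.sum_mul]
  simp_rw [← map_mul]
  exact sum_stab_mul ht (fun σ => MonoidAlgebra.of ℂ (Equiv.Perm (Fin m)) σ)

theorem CS_mul_of {m : ℕ} {r : Fin m → ℕ} {t : Equiv.Perm (Fin m)} (ht : t ∈ stab r) :
    CS r * MonoidAlgebra.of ℂ _ t = sg t • CS r := by
  rw [CS, Finset.sum_mul, Finset.smul_sum,
    ← sum_stab_mul ht (fun σ => sg t • sg σ • MonoidAlgebra.of ℂ (Equiv.Perm (Fin m)) σ)]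
  refine Finset.sum_congr rfl fun σ _ => ?_
  rw [smul_mul_assoc, ← map_mul, smul_smul, sg_mul, mul_comm (sg σ), ← mul_assoc, sg_sq, one_mul]

theorem RS_sq {m : ℕ} (r : Fin m → ℕ) : RS r * RS r = ((stab r).card : ℂ) • RS r := by
  conv_lhs => rw [RS.eq_1 r]
  rw [← RS.eq_1 r]
  conv_lhs => arg 2; rw [RS]
  rw [Finset.mul_sum, Finset.sum_congr rfl (fun t ht => RS_mul_of ht), Finset.sum_const,
    ← Nat.cast_smul_eq_nsmul ℂ]

theorem CS_sq {m : ℕ} (r : Fin m → ℕ) : CS r * CS r = ((stab r).card : ℂ) • CS r := by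
  conv_lhs => arg 2; rw [CS]
  rw [Finset.mul_sum]
  have : ∀ t ∈ stab r, CS r * sg t • MonoidAlgebra.of ℂ (Equiv.Perm (Fin m)) t = CS r := by
    intro t ht
    rw [mul_smul_comm, CS_mul_of ht, smul_smul, sg_sq, one_smul]
  rw [Finset.sum_congr rfl this, Finset.sum_const, ← Nat.cast_smul_eq_nsmul ℂ]

theorem RS_adj {m : ℕ} (r : Fin m → ℕ) (u v : MonoidAlgebra ℂ (Equiv.Perm (Fin m))) :
    ip (u * RS r) v = ip u (v * RS r) := by
  rw [RS, Finset.mul_sum, Finset.mul_sum, ip_sum_left, ip_sum_right, ← sum_stab_inv]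
  refine Finset.sum_congr rfl fun σ _ => ?_
  rw [ip_mul_of, inv_inv]

theorem CS_adj {m : ℕ} (r : Fin m → ℕ) (u v : MonoidAlgebra ℂ (Equiv.Perm (Fin m))) :
    ip (u * CS r) v = ip u (v * CS r) := by
  rw [CS, Finset.mul_sum, Finset.mul_sum, ip_sum_left, ip_sum_right, ← sum_stab_inv]
  refine Finset.sum_congr rfl fun σ _ => ?_
  rw [mul_smul_comm, mul_smul_comm, ip_smul_left, ip_smul_right, ip_mul_of, inv_inv, sg_inv,
    sg_conj]

theorem card_stab_ne {m : ℕ} (r : Fin m → ℕ) : ((stab r).card : ℂ) ≠ 0 := by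
  exact_mod_cast (Finset.card_pos.mpr ⟨1, one_mem_stab⟩).ne'

/-- Right multiplication is injective between `ℂS·a·b` and `ℂS·b·a`. -/
theorem inj_aux {G : Type*} [Fintype G] [Group G] {a b : MonoidAlgebra ℂ G} {N : ℂ}
    (ha : ∀ u v, ip (u * a) v = ip u (v * a)) (hb : ∀ u v, ip (u * b) v = ip u (v * b))
    (hbb : b * b = N • b) {x y : MonoidAlgebra ℂ G} (hy : y = x * (a * b)) (h0 : y * a = 0) :
    y = 0 := by
  apply ip_self
  have h1 : y * b = N • y := by rw [hy, mul_assoc, mul_assoc, hbb]; simp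
  have : ip y y = ip x ((y * b) * a) := by
    conv_lhs => arg 1; rw [hy, ← mul_assoc]
    rw [hb, ha]
  rw [this, h1, smul_mul_assoc, h0, smul_zero]
  simp [ip, Lf_apply]

/-- Sign twist. -/
noncomputable def twist (m : ℕ) :
    MonoidAlgebra ℂ (Equiv.Perm (Fin m)) →ₐ[ℂ] MonoidAlgebra ℂ (Equiv.Perm (Fin m)) :=
  MonoidAlgebra.lift ℂ _ _
    { toFun := fun σ => sg σ • MonoidAlgebra.of ℂ (Equiv.Perm (Fin m)) σ
      map_one' := by simp [sg, MonoidAlgebra.one_def]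
      map_mul' := fun σ τ => by
        rw [map_mul, sg_mul, smul_mul_smul_comm] }

theorem twist_of {m : ℕ} (σ : Equiv.Perm (Fin m)) :
    twist m (MonoidAlgebra.of ℂ _ σ) = sg σ • MonoidAlgebra.of ℂ (Equiv.Perm (Fin m)) σ := by
  rw [twist, MonoidAlgebra.lift_of]; rfl

theorem twist_twist {m : ℕ} (w : MonoidAlgebra ℂ (Equiv.Perm (Fin m))) :
    twist m (twist m w) = w := by
  induction w using MonoidAlgebra.induction_on with
  | of σ => rw [twist_of, map_smul, twist_of, smul_smul, sg_sq, one_smul]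
  | add x y hx hy => rw [map_add, map_add, hx, hy]
  | smul r x hx => rw [map_smul, map_smul, hx]

theorem twist_CS {m : ℕ} (r : Fin m → ℕ) : twist m (CS r) = RS r := by
  rw [CS, map_sum, RS]
  refine Finset.sum_congr rfl fun σ _ => ?_
  rw [map_smul, twist_of, smul_smul, sg_sq, one_smul]

theorem twist_RS {m : ℕ} (r : Fin m → ℕ) : twist m (RS r) = CS r := by
  rw [← twist_CS, twist_twist]


theorem pair_low {n : ℕ} (q : Fin n) : pairInvolution n (lowIdx n q) = highIdx n q := by
  simp only [pairInvolution, lowIdx, highIdx, Equiv.permCongr_apply, Equiv.symm_apply_apply]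
  rfl

theorem pair_high {n : ℕ} (q : Fin n) : pairInvolution n (highIdx n q) = lowIdx n q := by
  simp only [pairInvolution, lowIdx, highIdx, Equiv.permCongr_apply, Equiv.symm_apply_apply]
  rfl

theorem low_inj {n : ℕ} {q q' : Fin n} : lowIdx n q = lowIdx n q' ↔ q = q' := by
  rw [lowIdx, lowIdx, Equiv.apply_eq_iff_eq, Sum.inl.injEq]

theorem high_inj {n : ℕ} {q q' : Fin n} : highIdx n q = highIdx n q' ↔ q = q' := by
  rw [highIdx, highIdx, Equiv.apply_eq_iff_eq, Sum.inr.injEq]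

theorem low_ne_high {n : ℕ} (q q' : Fin n) : lowIdx n q ≠ highIdx n q' := by
  rw [lowIdx, highIdx, Ne, Equiv.apply_eq_iff_eq]
  exact Sum.inl_ne_inr

theorem low_or_high {n : ℕ} (p : Fin (n + n)) :
    (∃ q, p = lowIdx n q) ∨ ∃ q, p = highIdx n q := by
  obtain ⟨s, rfl⟩ := finSumFinEquiv.surjective p
  rcases s with q | q
  · exact Or.inl ⟨q, rfl⟩
  · exact Or.inr ⟨q, rfl⟩

theorem mem_hyp {n : ℕ} {σ : Equiv.Perm (Fin (n + n))} :
    σ ∈ hyperoctahedral n ↔ ∀ q, σ (highIdx n q) = pairInvolution n (σ (lowIdx n q)) := by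
  rw [hyperoctahedral, Finset.mem_filter]
  simp only [Finset.mem_univ, true_and]
  constructor
  · intro h q
    have := congrArg (fun τ : Equiv.Perm _ => τ (lowIdx n q)) h
    simpa [pair_low] using this
  · intro h
    ext1 p
    rcases low_or_high p with ⟨q, rfl⟩ | ⟨q, rfl⟩
    · simp [pair_low, h]
    · simp only [Equiv.Perm.mul_apply, pair_high, h]
      rcases low_or_high (σ (lowIdx n q)) with ⟨q', h'⟩ | ⟨q', h'⟩ <;>
        simp [h', pair_low, pair_high]

theorem hyp_mul {n : ℕ} {σ τ : Equiv.Perm (Fin (n + n))} (h : σ ∈ hyperoctahedral n)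
    (h' : τ ∈ hyperoctahedral n) : σ * τ ∈ hyperoctahedral n := by
  simp only [hyperoctahedral, Finset.mem_filter, Finset.mem_univ, true_and] at *
  rw [mul_assoc, h', ← mul_assoc, h, mul_assoc]

theorem hyp_inv {n : ℕ} {σ : Equiv.Perm (Fin (n + n))} (h : σ ∈ hyperoctahedral n) :
    σ⁻¹ ∈ hyperoctahedral n := by
  simp only [hyperoctahedral, Finset.mem_filter, Finset.mem_univ, true_and] at *
  rw [inv_mul_eq_iff_eq_mul, ← mul_assoc, h, mul_assoc, mul_inv_cancel, mul_one]

theorem hyp_one {n : ℕ} : (1 : Equiv.Perm (Fin (n + n))) ∈ hyperoctahedral n := by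
  simp [hyperoctahedral]

theorem hyp_cases {n : ℕ} {h : Equiv.Perm (Fin (n + n))} (hh : h ∈ hyperoctahedral n) :
    ∃ π : Equiv.Perm (Fin n), ∀ q,
      (h (lowIdx n q) = lowIdx n (π q) ∧ h (highIdx n q) = highIdx n (π q)) ∨
      (h (lowIdx n q) = highIdx n (π q) ∧ h (highIdx n q) = lowIdx n (π q)) := by
  rw [mem_hyp] at hh
  have h1 : ∀ q, ∃ q',
      (h (lowIdx n q) = lowIdx n q' ∧ h (highIdx n q) = highIdx n q') ∨
      (h (lowIdx n q) = highIdx n q' ∧ h (highIdx n q) = lowIdx n q') := by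
    intro q
    rcases low_or_high (h (lowIdx n q)) with ⟨q', h'⟩ | ⟨q', h'⟩
    · exact ⟨q', Or.inl ⟨h', by rw [hh, h', pair_low]⟩⟩
    · exact ⟨q', Or.inr ⟨h', by rw [hh, h', pair_high]⟩⟩
  choose π hπ using h1
  have hinj : Function.Injective π := by
    intro q q' e
    rcases hπ q with ⟨a, b⟩ | ⟨a, b⟩ <;> rcases hπ q' with ⟨a', b'⟩ | ⟨a', b'⟩
    · rw [e, ← a'] at a; exact low_inj.mp (h.injective a)
    · rw [e, ← b'] at a; exact absurd (h.injective a) (low_ne_high _ _)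
    · rw [e, ← b'] at a; exact absurd (h.injective a) (low_ne_high _ _)
    · rw [e, ← a'] at a; exact low_inj.mp (h.injective a)
  exact ⟨Equiv.ofBijective π (Finite.injective_iff_bijective.mp hinj), hπ⟩

theorem hyp_of_cases {n : ℕ} (π : Equiv.Perm (Fin n)) (S : Fin n → Prop) [DecidablePred S] :
    ∃ h ∈ hyperoctahedral n, ∀ q,
      h (lowIdx n q) = (if S q then lowIdx n (π q) else highIdx n (π q)) ∧
      h (highIdx n q) = (if S q then highIdx n (π q) else lowIdx n (π q)) := by
  let F : Fin n ⊕ Fin n → Fin (n + n) := Sum.elim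
    (fun q => if S q then lowIdx n (π q) else highIdx n (π q))
    (fun q => if S q then highIdx n (π q) else lowIdx n (π q))
  let g : Fin (n + n) → Fin (n + n) := fun p => F (finSumFinEquiv.symm p)
  have hgl : ∀ q, g (lowIdx n q) = (if S q then lowIdx n (π q) else highIdx n (π q)) := by
    intro q; simp only [g, lowIdx, Equiv.symm_apply_apply]; rfl
  have hgh : ∀ q, g (highIdx n q) = (if S q then highIdx n (π q) else lowIdx n (π q)) := by
    intro q; simp only [g, highIdx, Equiv.symm_apply_apply]; rfl
  have hsurj : Function.Surjective g := by
    intro p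
    rcases low_or_high p with ⟨q, rfl⟩ | ⟨q, rfl⟩
    · by_cases hS : S (π.symm q)
      · exact ⟨lowIdx n (π.symm q), by rw [hgl]; simp [hS]⟩
      · exact ⟨highIdx n (π.symm q), by rw [hgh]; simp [hS]⟩
    · by_cases hS : S (π.symm q)
      · exact ⟨highIdx n (π.symm q), by rw [hgh]; simp [hS]⟩
      · exact ⟨lowIdx n (π.symm q), by rw [hgl]; simp [hS]⟩
  refine ⟨Equiv.ofBijective g (Finite.surjective_iff_bijective.mp hsurj), ?_, ?_⟩
  · rw [mem_hyp]
    intro q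
    simp only [Equiv.ofBijective_apply, hgl, hgh]
    split_ifs <;> simp [pair_low, pair_high]
  · intro q
    exact ⟨hgl q, hgh q⟩

theorem sign_of_low {n : ℕ} {h : Equiv.Perm (Fin (n + n))} (hh : h ∈ hyperoctahedral n)
    (hl : ∀ q, ∃ r, h (lowIdx n q) = lowIdx n r) : Equiv.Perm.sign h = 1 := by
  obtain ⟨π, hπ⟩ := hyp_cases hh
  have : h = finSumFinEquiv.permCongr (Equiv.sumCongr π π) := by
    ext1 p
    have key : ∀ q, h (lowIdx n q) = lowIdx n (π q) ∧ h (highIdx n q) = highIdx n (π q) := by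
      intro q
      rcases hπ q with h1 | h1
      · exact h1
      · obtain ⟨r, hr⟩ := hl q
        exact absurd (hr.symm.trans h1.1) (low_ne_high _ _)
    rcases low_or_high p with ⟨q, rfl⟩ | ⟨q, rfl⟩
    · rw [(key q).1]
      simp only [lowIdx, Equiv.permCongr_apply, Equiv.symm_apply_apply]; rfl
    · rw [(key q).2]
      simp only [highIdx, Equiv.permCongr_apply, Equiv.symm_apply_apply]; rfl
  rw [this, Equiv.Perm.sign_permCongr]
  change Equiv.Perm.sign (Equiv.Perm.sumCongr π π) = 1
  rw [Equiv.Perm.sign_sumCongr]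
  exact Int.units_mul_self _

theorem sg_eq_chi {n : ℕ} {h : Equiv.Perm (Fin (n + n))} (hh : h ∈ hyperoctahedral n) :
    sg h = chiMinus n h := by
  rw [chiMinus]
  generalize hN : (Finset.univ.filter
    (fun q : Fin n => ∃ r : Fin n, h (lowIdx n q) = highIdx n r)).card = N
  induction N generalizing h with
  | zero =>
    rw [Finset.card_eq_zero, Finset.filter_eq_empty_iff] at hN
    rw [sg, sign_of_low hh]
    · simp
    · intro q
      rcases low_or_high (h (lowIdx n q)) with h' | h'
      · exact h'
      · exact absurd h' (hN (Finset.mem_univ q))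
  | succ N ih =>
    obtain ⟨q, hq⟩ : (Finset.univ.filter
      (fun q : Fin n => ∃ r : Fin n, h (lowIdx n q) = highIdx n r)).Nonempty := by
      rw [← Finset.card_pos, hN]; omega
    simp only [Finset.mem_filter, Finset.mem_univ, true_and] at hq
    obtain ⟨r, hr⟩ := hq
    have hsw : Equiv.swap (lowIdx n q) (highIdx n q) ∈ hyperoctahedral n := by
      rw [mem_hyp]
      intro q'
      by_cases e : q' = q
      · subst e; simp [pair_high]
      · rw [Equiv.swap_apply_of_ne_of_ne, Equiv.swap_apply_of_ne_of_ne, pair_low]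
        · rwa [Ne, low_inj]
        · exact low_ne_high _ _
        · exact (low_ne_high _ _).symm
        · rwa [Ne, high_inj]
    have h2 := ih (hyp_mul hh hsw) (by
      have : (Finset.univ.filter (fun q' : Fin n => ∃ r : Fin n,
          (h * Equiv.swap (lowIdx n q) (highIdx n q)) (lowIdx n q') = highIdx n r)) =
          (Finset.univ.filter
            (fun q : Fin n => ∃ r : Fin n, h (lowIdx n q) = highIdx n r)).erase q := by
        ext q'
        simp only [Finset.mem_filter, Finset.mem_univ, true_and, Finset.mem_erase]
        simp only [Equiv.Perm.mul_apply]
        by_cases e : q' = q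
        · subst e
          simp only [Equiv.swap_apply_left, ne_eq, not_true_eq_false, false_and, iff_false,
            not_exists]
          intro r'
          rw [mem_hyp.mp hh, hr, pair_high]
          exact low_ne_high _ _
        · rw [Equiv.swap_apply_of_ne_of_ne]
          · simp [e]
          · rwa [Ne, low_inj]
          · exact low_ne_high _ _
      rw [this, Finset.card_erase_of_mem, hN]
      · rfl
      · simp only [Finset.mem_filter, Finset.mem_univ, true_and]
        exact ⟨r, hr⟩)
    rw [sg_mul] at h2
    have h3 : sg (Equiv.swap (lowIdx n q) (highIdx n q)) = -1 := by
      rw [sg, Equiv.Perm.sign_swap (low_ne_high _ _)]; simp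
    rw [h3] at h2
    rw [pow_succ, ← h2]; ring

/-- Monomial attached to a word. -/
noncomputable def mon {n k : ℕ} (X : Matrix (Fin k) (Fin k) ℂ) (ψ : Fin (n + n) → Fin k) : ℂ :=
  ∏ q, X (ψ (lowIdx n q)) (ψ (highIdx n q))

theorem mon_hyp {n k : ℕ} {X : Matrix (Fin k) (Fin k) ℂ} (hX : ∀ i j, X i j = X j i)
    (ψ : Fin (n + n) → Fin k) {h : Equiv.Perm (Fin (n + n))} (hh : h ∈ hyperoctahedral n) :
    mon X (fun p => ψ (h p)) = mon X ψ := by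
  obtain ⟨π, hπ⟩ := hyp_cases hh
  rw [mon, mon]
  refine Fintype.prod_equiv π _ _ fun q => ?_
  rcases hπ q with ⟨a, b⟩ | ⟨a, b⟩
  · rw [a, b]
  · rw [a, b, hX]

/-- The evaluation functional. -/
noncomputable def Q {n k : ℕ} (X : Matrix (Fin k) (Fin k) ℂ) (ψ : Fin (n + n) → Fin k) :
    MonoidAlgebra ℂ (Equiv.Perm (Fin (n + n))) →ₗ[ℂ] ℂ :=
  Lf (fun σ => mon X (fun p => ψ (σ⁻¹ p)))

theorem Q_mul_of {n k : ℕ} (X : Matrix (Fin k) (Fin k) ℂ) (ψ : Fin (n + n) → Fin k)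
    (w : MonoidAlgebra ℂ (Equiv.Perm (Fin (n + n)))) (g : Equiv.Perm (Fin (n + n)))
    (hg : ∀ p, ψ (g p) = ψ p) :
    Q X ψ (w * MonoidAlgebra.of ℂ _ g) = Q X ψ w := by
  have : ∀ p, ψ (g⁻¹ p) = ψ p := fun p => by
    have := hg (g⁻¹ p)
    simpa using this.symm
  rw [Q, Lf_mul_of]
  simp only [mul_inv_rev, Equiv.Perm.mul_apply, this]

theorem Q_of_mul {n k : ℕ} {X : Matrix (Fin k) (Fin k) ℂ} (hX : ∀ i j, X i j = X j i)
    (ψ : Fin (n + n) → Fin k)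
    (w : MonoidAlgebra ℂ (Equiv.Perm (Fin (n + n)))) {h : Equiv.Perm (Fin (n + n))}
    (hh : h ∈ hyperoctahedral n) :
    Q X ψ (MonoidAlgebra.of ℂ _ h * w) = Q X ψ w := by
  rw [Q, Lf_of_mul]
  have : ∀ σ : Equiv.Perm (Fin (n + n)), mon X (fun p => ψ ((h * σ)⁻¹ p)) =
      mon X (fun p => ψ (σ⁻¹ p)) := by
    intro σ
    rw [← mon_hyp hX (fun p => ψ (σ⁻¹ p)) (hyp_inv hh)]
    simp
  simp only [this]

theorem Q_CS {n k : ℕ} (X : Matrix (Fin k) (Fin k) ℂ) (ψ : Fin (n + n) → Fin k)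
    (w : MonoidAlgebra ℂ (Equiv.Perm (Fin (n + n)))) (c : Fin (n + n) → ℕ)
    {p p' : Fin (n + n)} (hp : p ≠ p') (hc : c p = c p') (hψ : ψ p = ψ p') :
    Q X ψ (w * CS c) = 0 := by
  have ht : Equiv.swap p p' ∈ stab c := by
    rw [mem_stab]; intro x
    rw [Equiv.swap_apply_def]; split_ifs with h1 h2
    · rw [h1, hc]
    · rw [h2, hc]
    · rfl
  have h1 := Q_mul_of X ψ (w * CS c) (Equiv.swap p p') (by
    intro x
    rw [Equiv.swap_apply_def]; split_ifs with h1 h2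
    · rw [h1, hψ]
    · rw [h2, hψ]
    · rfl)
  rw [mul_assoc, CS_mul_of ht, sg, Equiv.Perm.sign_swap hp] at h1
  simp only [Units.val_neg, Units.val_one, Int.cast_neg, Int.cast_one, neg_smul, one_smul,
    mul_neg, map_neg] at h1
  have h2 : (2 : ℂ) * Q X ψ (w * CS c) = 0 := by linear_combination - h1
  simpa using h2

theorem Q_RS {n k : ℕ} (X : Matrix (Fin k) (Fin k) ℂ) (ψ : Fin (n + n) → Fin k)
    (w : MonoidAlgebra ℂ (Equiv.Perm (Fin (n + n)))) :
    Q X ψ (w * RS (fun p => (ψ p : ℕ))) = ((stab (fun p => (ψ p : ℕ))).card : ℂ) * Q X ψ w := by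
  rw [RS, Finset.mul_sum, map_sum, Finset.sum_congr rfl (fun σ hσ => Q_mul_of X ψ w σ ?_)]
  · simp
  · intro p
    exact Fin.ext (mem_stab.mp hσ p)

theorem prod_low_high {n : ℕ} {M : Type*} [CommMonoid M] (F : Fin (n + n) → M) :
    ∏ p, F p = ∏ q, (F (lowIdx n q) * F (highIdx n q)) := by
  rw [← Equiv.prod_comp finSumFinEquiv, Fintype.prod_sum_type, Finset.prod_mul_distrib]
  rfl

theorem word_bij (n k : ℕ) : Function.Bijective
    (fun (ψ : Fin (n + n) → Fin k) (q : Fin n) => (ψ (lowIdx n q), ψ (highIdx n q))) := by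
  constructor
  · intro ψ ψ' h
    funext p
    rcases low_or_high p with ⟨q, rfl⟩ | ⟨q, rfl⟩
    · exact (Prod.ext_iff.mp (congrFun h q)).1
    · exact (Prod.ext_iff.mp (congrFun h q)).2
  · intro F
    refine ⟨fun p => Sum.elim (fun q => (F q).1) (fun q => (F q).2) (finSumFinEquiv.symm p), ?_⟩
    funext q
    simp only [lowIdx, highIdx, Equiv.symm_apply_apply, Sum.elim_inl, Sum.elim_inr]

open Matrix in
theorem mon_conj {n k : ℕ} (X g : Matrix (Fin k) (Fin k) ℂ) (φ : Fin (n + n) → Fin k) :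
    mon (gᵀ * X * g) φ = ∑ ψ : Fin (n + n) → Fin k, (∏ p, g (ψ p) (φ p)) * mon X ψ := by
  have h1 : ∀ a b, (gᵀ * X * g) a b = ∑ x : Fin k × Fin k, g x.1 a * X x.1 x.2 * g x.2 b := by
    intro a b
    rw [Matrix.mul_apply, Fintype.sum_prod_type_right]
    refine Finset.sum_congr rfl fun j _ => ?_
    rw [Matrix.mul_apply, Finset.sum_mul]
    rfl
  rw [mon]
  simp_rw [h1]
  rw [Finset.prod_univ_sum, Fintype.piFinset_univ]
  symm
  refine Fintype.sum_bijective _ (word_bij n k) _ _ fun ψ => ?_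
  rw [prod_low_high, mon, ← Finset.prod_mul_distrib]
  refine Finset.prod_congr rfl fun q _ => ?_
  ring

open Matrix in
theorem Q_conj {n k : ℕ} (X g : Matrix (Fin k) (Fin k) ℂ) (r : Fin (n + n) → Fin k)
    (w : MonoidAlgebra ℂ (Equiv.Perm (Fin (n + n)))) :
    Q (gᵀ * X * g) r w = ∑ ψ : Fin (n + n) → Fin k, (∏ p, g (ψ p) (r p)) * Q X ψ w := by
  simp only [Q, Lf_apply, mon_conj, Finset.mul_sum]
  rw [Finset.sum_comm' (t' := Finset.univ) (s' := fun _ => Finset.univ) (by simp)]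
  conv_rhs => rw [Finset.sum_comm' (t' := Finset.univ) (s' := fun _ => Finset.univ) (by simp)]
  rw [Finset.sum_comm' (t' := Finset.univ) (s' := fun _ => Finset.univ) (by simp)]
  refine Finset.sum_congr rfl fun σ _ => ?_
  symm
  refine Fintype.sum_equiv (Equiv.arrowCongr σ (Equiv.refl _)) _ _ fun ψ => ?_
  have h1 : ∏ p, g (ψ p) (r p) =
      ∏ p, g ((Equiv.arrowCongr σ (Equiv.refl (Fin k))) ψ p) (r (σ⁻¹ p)) :=
    Fintype.prod_equiv σ _ _ fun p => by simp [Equiv.arrowCongr]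
  rw [← h1]
  have h2 : (fun p => ψ (σ⁻¹ p)) = (Equiv.arrowCongr σ (Equiv.refl (Fin k))) ψ := by
    funext p
    rfl
  rw [h2]
  ring

/-- Column-strictness rigidity. -/
def Rigid {n k : ℕ} (r : Fin (n + n) → Fin k) (c : Fin (n + n) → ℕ) : Prop :=
  ∀ ψ : Fin (n + n) → Fin k, (∀ p, ψ p ≤ r p) →
    (∀ p p', p ≠ p' → c p = c p' → ψ p ≠ ψ p') → ψ = r

open Matrix in
theorem Q_semi {n k : ℕ} {r : Fin (n + n) → Fin k} {c : Fin (n + n) → ℕ} (hr : Rigid r c)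
    (X g : Matrix (Fin k) (Fin k) ℂ) (hg : ∀ i j, j < i → g i j = 0)
    (w : MonoidAlgebra ℂ (Equiv.Perm (Fin (n + n)))) :
    Q (gᵀ * X * g) r (w * CS c) = (∏ p, g (r p) (r p)) * Q X r (w * CS c) := by
  rw [Q_conj, Finset.sum_eq_single r]
  · intro ψ _ hψ
    by_cases h1 : ∀ p, ψ p ≤ r p
    · by_cases h2 : ∀ p p', p ≠ p' → c p = c p' → ψ p ≠ ψ p'
      · exact absurd (hr ψ h1 h2) hψ
      · push Not at h2
        obtain ⟨p, p', a, b, d⟩ := h2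
        rw [Q_CS X ψ w c a b d, mul_zero]
    · push Not at h1
      obtain ⟨p, hp⟩ := h1
      rw [Finset.prod_eq_zero (Finset.mem_univ p) (hg _ _ hp), zero_mul]
  · simp

open Matrix in
theorem Q_posdef {n k : ℕ} {r : Fin (n + n) → Fin k} {c : Fin (n + n) → ℕ} (hr : Rigid r c)
    (w : MonoidAlgebra ℂ (Equiv.Perm (Fin (n + n)))) (h1 : Q 1 r (w * CS c) = 0)
    (S : Matrix (Fin k) (Fin k) ℝ) (hS : S.PosDef) :
    Q (S.map (fun x : ℝ => (x : ℂ))) r (w * CS c) = 0 := by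
  have hd : ∀ d : Fin k → ℂ, Q (Matrix.diagonal d) r (w * CS c) = 0 := by
    intro d
    have hsq : ∀ i, ∃ z : ℂ, d i = z * z := fun i => by
      obtain ⟨z, hz⟩ := IsAlgClosed.exists_pow_nat_eq (d i) (n := 2) (by norm_num)
      exact ⟨z, by rw [← hz, sq]⟩
    choose z hz using hsq
    have := Q_semi hr 1 (Matrix.diagonal z) (fun i j hij => Matrix.diagonal_apply_ne _ hij.ne') w
    rw [h1, mul_zero, Matrix.diagonal_transpose, mul_one, Matrix.diagonal_mul_diagonal] at this
    have hzz : d = fun i => z i * z i := funext hz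
    rw [← this, ← hzz]
  let L := LDL.lowerInv hS
  let g : Matrix (Fin k) (Fin k) ℂ := (L.map (fun x : ℝ => (x : ℂ)))ᵀ
  have hLtri : ∀ i j, i < j → L i j = 0 := fun i j hij => LDL.lowerInv_triangular hS hij
  have hdet : L.det ≠ 0 := by
    have : IsUnit L := isUnit_of_invertible (LDL.lowerInv hS)
    exact ((Matrix.isUnit_iff_isUnit_det L).mp this).ne_zero
  have hdiag : ∀ i, L i i ≠ 0 := by
    rw [Matrix.det_of_isLowerTriangular L (fun i j hij => hLtri i j hij)] at hdet
    intro i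
    exact (Finset.prod_ne_zero_iff.mp hdet) i (Finset.mem_univ i)
  have key := Q_semi hr (S.map (fun x : ℝ => (x : ℂ))) g (fun i j hij => by
    simp [g, hLtri j i hij]) w
  have hconj : gᵀ * S.map (fun x : ℝ => (x : ℂ)) * g =
      Matrix.diagonal (fun i => ((LDL.diagEntries hS i : ℝ) : ℂ)) := by
    have h2 : LDL.diag hS = L * S * Lᵀ := by
      rw [LDL.diag_eq_lowerInv_conj]
      simp [L]
    have h3 := congrArg (fun M : Matrix (Fin k) (Fin k) ℝ => M.map (Complex.ofRealHom)) h2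
    simp only [Matrix.map_mul, LDL.diag] at h3
    rw [Matrix.diagonal_map (by simp)] at h3
    simp only [g, Matrix.transpose_transpose]
    exact h3.symm
  rw [hconj, hd] at key
  refine (mul_eq_zero.mp key.symm).resolve_left ?_
  refine Finset.prod_ne_zero_iff.mpr ?_
  intro p _
  simp [g, hdiag]

theorem posdef_dom {k : ℕ} (S : Matrix (Fin k) (Fin k) ℝ) (hsym : ∀ i j, S i j = S j i)
    (hoff : ∀ i j, i ≠ j → |S i j| ≤ 1) (hdi : ∀ i, (k : ℝ) + 1 < S i i) : S.PosDef := by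
  refine Matrix.PosDef.of_dotProduct_mulVec_pos ?_ ?_
  · ext i j; simp [hsym i j]
  · intro x hx
    have h1 : star x ⬝ᵥ (S.mulVec x) = ∑ i, ∑ j, x i * S i j * x j := by
      simp only [dotProduct, Matrix.mulVec, Finset.mul_sum]
      simp [mul_assoc]
    rw [h1]
    have h2 : ∀ i j, (if i = j then x i ^ 2 * (k + 1) else 0) - (x i ^ 2 + x j ^ 2) / 2
        ≤ x i * S i j * x j := by
      intro i j
      split_ifs with h
      · subst h
        nlinarith [hdi i, sq_nonneg (x i), mul_nonneg (sq_nonneg (x i)) (sub_nonneg.mpr (hdi i).le)]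
      · have := abs_le.mp (hoff i j h)
        nlinarith [mul_nonneg (sub_nonneg.mpr this.2) (sq_nonneg (x i - x j)),
          mul_nonneg (sub_nonneg.mpr this.1) (sq_nonneg (x i + x j))]
    have h3 : ∑ i, ∑ j, ((if i = j then x i ^ 2 * ((k : ℝ) + 1) else 0) - (x i ^ 2 + x j ^ 2) / 2)
        = ∑ i, x i ^ 2 := by
      simp only [Finset.sum_sub_distrib, Finset.sum_ite_eq, Finset.mem_univ, if_true, add_div,
        Finset.sum_add_distrib, Finset.sum_const, Finset.card_univ, Fintype.card_fin, nsmul_eq_mul,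
        ← Finset.sum_mul, ← Finset.mul_sum, ← Finset.sum_div]
      ring
    have h4 : 0 < ∑ i, x i ^ 2 := by
      obtain ⟨i, hi⟩ := Function.ne_iff.mp hx
      exact Finset.sum_pos' (fun i _ => sq_nonneg _) ⟨i, Finset.mem_univ i, by
        have : x i ≠ 0 := hi
        positivity⟩
    calc 0 < _ := h4
      _ = _ := h3.symm
      _ ≤ _ := Finset.sum_le_sum fun i _ => Finset.sum_le_sum fun j _ => h2 i j

theorem exists_perm_of_fiber {n : ℕ} {β : Type*} [DecidableEq β] (u v : Fin n → β)
    (h : ∀ b, (Finset.univ.filter (fun q => u q = b)).card =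
      (Finset.univ.filter (fun q => v q = b)).card) :
    ∃ π : Equiv.Perm (Fin n), ∀ q, v (π q) = u q := by
  have e : ∀ b, Nonempty ({q // u q = b} ≃ {q // v q = b}) := fun b =>
    ⟨Fintype.equivOfCardEq (by rw [Fintype.card_subtype, Fintype.card_subtype, h b])⟩
  refine ⟨(Equiv.sigmaFiberEquiv u).symm.trans
    ((Equiv.sigmaCongrRight fun b => (e b).some).trans (Equiv.sigmaFiberEquiv v)), fun q => ?_⟩
  exact ((e (u q)).some ⟨q, rfl⟩).2

/-- Pair of labels. -/
def lab {n k : ℕ} (r : Fin (n + n) → Fin k) (σ : Equiv.Perm (Fin (n + n))) (q : Fin n) :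
    Sym2 (Fin k) :=
  s(r (σ⁻¹ (lowIdx n q)), r (σ⁻¹ (highIdx n q)))

/-- Exponent vector. -/
noncomputable def expo {n k : ℕ} (r : Fin (n + n) → Fin k) (σ : Equiv.Perm (Fin (n + n))) :
    Sym2 (Fin k) →₀ ℕ :=
  ∑ q, Finsupp.single (lab r σ q) 1

theorem expo_apply {n k : ℕ} (r : Fin (n + n) → Fin k) (σ : Equiv.Perm (Fin (n + n)))
    (z : Sym2 (Fin k)) :
    expo r σ z = (Finset.univ.filter (fun q => lab r σ q = z)).card := by
  rw [expo, Finsupp.finsetSum_apply, Finset.card_filter]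
  exact Finset.sum_congr rfl fun q _ => by rw [Finsupp.single_apply]

theorem coset_of_expo {n k : ℕ} (r : Fin (n + n) → Fin k) {σ σ' : Equiv.Perm (Fin (n + n))}
    (h : expo r σ = expo r σ') :
    ∃ g ∈ hyperoctahedral n, ∃ ρ ∈ stab (fun p => (r p : ℕ)), g * σ = σ' * ρ := by
  classical
  obtain ⟨π, hπ⟩ := exists_perm_of_fiber (lab r σ) (lab r σ') (fun b => by
    rw [← expo_apply, ← expo_apply, h])
  obtain ⟨g, hg, hgq⟩ := hyp_of_cases π
    (fun q => r (σ'⁻¹ (lowIdx n (π q))) = r (σ⁻¹ (lowIdx n q)) ∧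
      r (σ'⁻¹ (highIdx n (π q))) = r (σ⁻¹ (highIdx n q)))
  refine ⟨g, hg, σ'⁻¹ * (g * σ), ?_, by simp⟩
  have key : ∀ p, r (σ'⁻¹ (g p)) = r (σ⁻¹ p) := by
    have hk : ∀ q, r (σ'⁻¹ (g (lowIdx n q))) = r (σ⁻¹ (lowIdx n q)) ∧
        r (σ'⁻¹ (g (highIdx n q))) = r (σ⁻¹ (highIdx n q)) := by
      intro q
      rw [(hgq q).1, (hgq q).2]
      have := hπ q
      rw [lab, lab, Sym2.eq_iff] at this
      split_ifs with hc
      · exact hc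
      · rcases this with h1 | h1
        · exact absurd h1 hc
        · exact ⟨h1.2, h1.1⟩
    intro p
    rcases low_or_high p with ⟨q, rfl⟩ | ⟨q, rfl⟩
    · exact (hk q).1
    · exact (hk q).2
  rw [mem_stab]
  intro p
  have := key (σ p)
  simp only [Equiv.Perm.mul_apply]
  rw [this]
  simp

theorem core {n k : ℕ} {r : Fin (n + n) → Fin k} {c : Fin (n + n) → ℕ} (hr : Rigid r c)
    {x w : MonoidAlgebra ℂ (Equiv.Perm (Fin (n + n)))}
    (hw : w = x * (CS c * RS (fun p => (r p : ℕ))))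
    (hinv : ∀ h ∈ hyperoctahedral n, MonoidAlgebra.of ℂ _ h * w = w)
    (h1 : Q 1 r w = 0) : w = 0 := by
  classical
  have hN := card_stab_ne (fun p => (r p : ℕ))
  have hw' : w = (x * CS c) * RS (fun p => (r p : ℕ)) := by rw [hw, mul_assoc]
  have h2 : Q 1 r (x * CS c) = 0 := by
    rw [hw', Q_RS] at h1
    exact (mul_eq_zero.mp h1).resolve_left hN
  have h3 : ∀ S : Matrix (Fin k) (Fin k) ℝ, S.PosDef →
      Q (S.map (fun x : ℝ => (x : ℂ))) r w = 0 := by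
    intro S hS
    rw [hw', Q_RS, Q_posdef hr x h2 S hS, mul_zero]
  have hleft : ∀ g ∈ hyperoctahedral n, ∀ σ, w.coeff (g * σ) = w.coeff σ := by
    intro g hg σ
    have := congrArg (fun y => y.coeff (g * σ)) (hinv g hg)
    simpa using this.symm
  have hright : ∀ ρ ∈ stab (fun p => (r p : ℕ)), ∀ σ, w.coeff (σ * ρ) = w.coeff σ := by
    intro ρ hρ σ
    have h4 : w * MonoidAlgebra.of ℂ _ ρ = w := by rw [hw', mul_assoc, RS_mul_of hρ]
    have := congrArg (fun y => y.coeff (σ * ρ)) h4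
    simpa using this.symm
  let P : MvPolynomial (Sym2 (Fin k)) ℂ := ∑ σ, MvPolynomial.monomial (expo r σ) (w.coeff σ)
  have heval : ∀ y : Sym2 (Fin k) → ℂ, MvPolynomial.eval y P =
      Q (fun i j => y s(i, j)) r w := by
    intro y
    simp only [P, map_sum, Q, Lf_apply, mon]
    refine Finset.sum_congr rfl fun σ _ => ?_
    rw [MvPolynomial.eval_monomial, expo, ← Finsupp.prod_finsetSum_index (by simp)
      (fun _ _ _ => pow_add _ _ _)]
    congr 1
    refine Finset.prod_congr rfl fun q _ => ?_
    rw [Finsupp.prod_single_index (by simp), pow_one]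
    rfl
  have hP : P = 0 := by
    refine MvPolynomial.funext_set
      (fun z => if z.IsDiag then (fun t : ℝ => (t : ℂ)) '' Set.Ioi ((k : ℝ) + 1)
        else (fun t : ℝ => (t : ℂ)) '' Set.Icc (0 : ℝ) 1) ?_ ?_
    · intro z
      split_ifs
      · exact (Set.Ioi_infinite _).image Complex.ofReal_injective.injOn
      · exact (Set.Icc_infinite (by norm_num)).image Complex.ofReal_injective.injOn
    · intro y hy
      rw [heval, map_zero]
      have hy' := fun z => hy z (Set.mem_univ z)
      have hre : ∀ z, ∃ t : ℝ, (t : ℂ) = y z ∧ (z.IsDiag → (k : ℝ) + 1 < t) ∧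
          (¬ z.IsDiag → |t| ≤ 1) := by
        intro z
        have := hy' z
        dsimp only at this
        split_ifs at this with hz
        · obtain ⟨t, ht, e⟩ := this
          exact ⟨t, e, fun _ => ht, fun h => absurd hz h⟩
        · obtain ⟨t, ht, e⟩ := this
          exact ⟨t, e, fun h => absurd h hz, fun _ => abs_le.mpr ⟨by linarith [ht.1], ht.2⟩⟩
      choose t ht1 ht2 ht3 using hre
      have := h3 (Matrix.of fun i j => t s(i, j)) (posdef_dom _
        (fun i j => by simp [Sym2.eq_swap]) (fun i j hij => ht3 _ (by simpa using hij))
        (fun i => ht2 _ (by simp)))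
      rw [← this]
      congr 2
      funext i j
      simp [ht1]
  apply MonoidAlgebra.ext
  ext σ₀
  have h5 : MvPolynomial.coeff (expo r σ₀) P = 0 := by rw [hP]; simp
  simp only [P, MvPolynomial.coeff_sum, MvPolynomial.coeff_monomial] at h5
  rw [← Finset.sum_filter] at h5
  have h6 : ∀ σ ∈ Finset.univ.filter (fun σ => expo r σ = expo r σ₀),
      w.coeff σ = w.coeff σ₀ := by
    intro σ hσ
    obtain ⟨g, hg, ρ, hρ, e⟩ := coset_of_expo r (Finset.mem_filter.mp hσ).2
    rw [← hleft g hg, e, hright ρ hρ]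
  rw [Finset.sum_congr rfl h6, Finset.sum_const, nsmul_eq_mul] at h5
  have h7 : ((Finset.univ.filter (fun σ => expo r σ = expo r σ₀)).card : ℂ) ≠ 0 := by
    exact_mod_cast (Finset.card_pos.mpr ⟨σ₀, by simp⟩).ne'
  simpa using (mul_eq_zero.mp h5).resolve_left h7

section Main
variable {n : ℕ} {ω : YoungDiagram} {f : Fin (n + n) → ℕ × ℕ}

theorem f_surj (hcard : ω.card = n + n) (hinj : Function.Injective f) (hmem : ∀ p, f p ∈ ω)
    {z : ℕ × ℕ} (hz : z ∈ ω) : ∃ p, f p = z := by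
  have h1 : Finset.univ.image f = ω.cells := by
    apply Finset.eq_of_subset_of_card_le
    · intro z hz
      obtain ⟨p, _, rfl⟩ := Finset.mem_image.mp hz
      exact hmem p
    · rw [Finset.card_image_of_injective _ hinj, Finset.card_univ, Fintype.card_fin]
      exact hcard.le
  have : z ∈ Finset.univ.image f := by rw [h1]; exact hz
  obtain ⟨p, _, hp⟩ := Finset.mem_image.mp this
  exact ⟨p, hp⟩

theorem row_lt (hmem : ∀ p, f p ∈ ω) (p : Fin (n + n)) : (f p).1 < ω.colLen 0 := by
  rw [← YoungDiagram.mem_iff_lt_colLen]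
  exact ω.up_left_mem le_rfl (Nat.zero_le _) (hmem p)

/-- The row labelling. -/
def rw' (hmem : ∀ p, f p ∈ ω) (p : Fin (n + n)) : Fin (ω.colLen 0) := ⟨(f p).1, row_lt hmem p⟩

theorem rigid (hcard : ω.card = n + n) (hinj : Function.Injective f) (hmem : ∀ p, f p ∈ ω) :
    Rigid (rw' hmem) (fun p => (f p).2) := by
  intro ψ h1 h2
  have key : ∀ N, ∀ p, (f p).1 = N → (ψ p : ℕ) = N := by
    intro N
    induction N using Nat.strong_induction_on with
    | _ N ih =>
      intro p hp
      have hle : (ψ p : ℕ) ≤ N := hp ▸ h1 p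
      rcases hle.lt_or_eq with hlt | heq
      · exfalso
        obtain ⟨p', hp'⟩ := f_surj hcard hinj hmem
          (ω.up_left_mem (i1 := (ψ p : ℕ)) (i2 := (f p).1) (by omega) le_rfl (hmem p))
        have h3 := ih _ hlt p' (by rw [hp'])
        refine h2 p p' ?_ (by simp only [hp']) (Fin.ext h3.symm)
        rintro rfl
        rw [hp'] at hp
        simp only at hp
        omega
      · exact heq
  funext p
  exact Fin.ext (key _ p rfl)

theorem rowLen_card (hcard : ω.card = n + n) (hinj : Function.Injective f) (hmem : ∀ p, f p ∈ ω)
    (i : ℕ) : ω.rowLen i = (Finset.univ.filter (fun p => (f p).1 = i)).card := by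
  rw [YoungDiagram.rowLen_eq_card, ← Finset.card_image_of_injective _ hinj]
  congr 1
  ext z
  simp only [YoungDiagram.mem_row_iff, Finset.mem_image, Finset.mem_filter, Finset.mem_univ,
    true_and]
  constructor
  · rintro ⟨h1, h2⟩
    obtain ⟨p, rfl⟩ := f_surj hcard hinj hmem h1
    exact ⟨p, h2, rfl⟩
  · rintro ⟨p, h1, rfl⟩
    exact ⟨hmem p, h1⟩

theorem even_of_inv (hcard : ω.card = n + n) (hinj : Function.Injective f) (hmem : ∀ p, f p ∈ ω)
    {x : MonoidAlgebra ℂ (Equiv.Perm (Fin (n + n)))}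
    (h : Q 1 (rw' hmem) (x * CS (fun p => (f p).2)) ≠ 0) (i : ℕ) : Even (ω.rowLen i) := by
  by_cases hi : i < ω.colLen 0
  · let d : Fin (ω.colLen 0) → ℂ := fun j => if j = ⟨i, hi⟩ then -1 else 1
    have h1 := Q_semi (rigid hcard hinj hmem) 1 (Matrix.diagonal d)
      (fun i j hij => Matrix.diagonal_apply_ne _ hij.ne') x
    have h2 : (Matrix.diagonal d).transpose * 1 * Matrix.diagonal d = 1 := by
      rw [Matrix.diagonal_transpose, mul_one, Matrix.diagonal_mul_diagonal,
        ← Matrix.diagonal_one]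
      congr 1
      funext j
      simp only [d]
      split_ifs <;> norm_num
    have h3 : ∏ p, (Matrix.diagonal d) (rw' hmem p) (rw' hmem p) = (-1 : ℂ) ^ (ω.rowLen i) := by
      rw [rowLen_card hcard hinj hmem, ← Finset.prod_const, Finset.prod_filter]
      refine Finset.prod_congr rfl fun p _ => ?_
      simp [d, rw', Fin.ext_iff]
    rw [h2, h3] at h1
    have h4 : (-1 : ℂ) ^ (ω.rowLen i) = 1 := by
      have h5 : ((-1 : ℂ) ^ (ω.rowLen i) - 1) * Q 1 (rw' hmem) (x * CS (fun p => (f p).2)) = 0 := by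
        linear_combination -h1
      exact sub_eq_zero.mp ((mul_eq_zero.mp h5).resolve_right h)
    by_contra hodd
    rw [Nat.not_even_iff_odd] at hodd
    rw [hodd.neg_one_pow] at h4
    norm_num at h4
  · have : ω.rowLen i = 0 := by
      by_contra h0
      apply hi
      rw [← YoungDiagram.mem_iff_lt_colLen, YoungDiagram.mem_iff_lt_rowLen]
      omega
    rw [this]
    exact Even.zero

/-- Partner of a column. -/
def flp (j : ℕ) : ℕ := if Even j then j + 1 else j - 1

theorem flp_flp (j : ℕ) : flp (flp j) = j := by
  unfold flp
  by_cases h : Even j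
  · simp [h, Nat.even_add_one]
  · have h1 : Even (j - 1) := by
      rw [Nat.not_even_iff_odd] at h
      obtain ⟨a, rfl⟩ := h
      simp
    have : j ≠ 0 := by rintro rfl; simp at h
    simp only [h, if_false, h1, if_true]
    omega

theorem even_flp (j : ℕ) : Even (flp j) ↔ ¬ Even j := by
  unfold flp
  by_cases h : Even j
  · simp [h, Nat.even_add_one]
  · simp only [h, if_false, not_false_iff, iff_true]
    rw [Nat.not_even_iff_odd] at h
    obtain ⟨a, rfl⟩ := h
    simp

theorem exists_partner (hcard : ω.card = n + n) (hinj : Function.Injective f)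
    (hmem : ∀ p, f p ∈ ω) (hev : ∀ i, Even (ω.rowLen i)) :
    ∃ u : Equiv.Perm (Fin (n + n)), ∃ τ : Fin (n + n) → Fin (n + n),
      (∀ p, f (τ p) = ((f p).1, flp (f p).2)) ∧
      (∀ q, Even (f (u (lowIdx n q))).2) ∧ (∀ q, u (highIdx n q) = τ (u (lowIdx n q))) ∧
      (∀ p, Even (f p).2 → ∃ q, p = u (lowIdx n q)) := by
  have hex : ∀ p, ∃ p', f p' = ((f p).1, flp (f p).2) := by
    intro p
    apply f_surj hcard hinj hmem
    rw [YoungDiagram.mem_iff_lt_rowLen]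
    have h1 : (f p).2 < ω.rowLen (f p).1 := YoungDiagram.mem_iff_lt_rowLen.mp (hmem p)
    unfold flp
    split_ifs with h
    · obtain ⟨a, ha⟩ := hev (f p).1
      obtain ⟨b, hb⟩ := h
      omega
    · omega
  choose τ hτ using hex
  have hττ : ∀ p, τ (τ p) = p := by
    intro p
    apply hinj
    rw [hτ, hτ]
    simp [flp_flp]
  have hce : (Finset.univ.filter (fun p => Even (f p).2)).card =
      (Finset.univ.filter (fun p => ¬ Even (f p).2)).card := by
    refine Finset.card_nbij' τ τ ?_ ?_ (fun p _ => hττ p) (fun p _ => hττ p)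
    · intro p hp
      simp only [Finset.coe_filter, Finset.mem_univ, true_and, Set.mem_setOf_eq] at *
      rw [hτ, even_flp]
      exact not_not_intro hp
    · intro p hp
      simp only [Finset.coe_filter, Finset.mem_univ, true_and, Set.mem_setOf_eq] at *
      rw [hτ, even_flp]
      exact hp
  have hcn : Fintype.card {p // Even (f p).2} = n := by
    rw [Fintype.card_subtype]
    have := Finset.card_filter_add_card_filter_not (s := (Finset.univ : Finset (Fin (n + n))))
      (fun p => Even (f p).2)
    rw [Finset.card_univ, Fintype.card_fin] at this
    omega
  let e : Fin n ≃ {p // Even (f p).2} := (Fintype.equivFinOfCardEq hcn).symm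
  let κ : Fin n ⊕ Fin n → Fin (n + n) := Sum.elim (fun q => (e q).1) (fun q => τ (e q).1)
  have hodd : ∀ q, ¬ Even (f (τ (e q).1)).2 := by
    intro q
    rw [hτ, even_flp]
    exact not_not_intro (e q).2
  have hκ : Function.Injective κ := by
    rintro (q | q) (q' | q') h
    · have h' : (e q).1 = (e q').1 := h
      rw [e.injective (Subtype.ext h')]
    · have h' : (e q).1 = τ (e q').1 := h
      exact absurd (h' ▸ (e q).2) (hodd q')
    · have h' : τ (e q).1 = (e q').1 := h
      exact absurd (h' ▸ (e q').2) (hodd q)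
    · have h' : τ (e q).1 = τ (e q').1 := h
      have h'' := congrArg τ h'
      rw [hττ, hττ] at h''
      rw [e.injective (Subtype.ext h'')]
  have hb : Function.Bijective κ := by
    rw [Fintype.bijective_iff_injective_and_card]
    exact ⟨hκ, by simp⟩
  have hl : ∀ q, (finSumFinEquiv.symm.trans (Equiv.ofBijective κ hb)) (lowIdx n q) = (e q).1 := by
    intro q
    simp only [lowIdx, Equiv.trans_apply, Equiv.symm_apply_apply]
    rfl
  have hh : ∀ q, (finSumFinEquiv.symm.trans (Equiv.ofBijective κ hb)) (highIdx n q) =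
      τ (e q).1 := by
    intro q
    simp only [highIdx, Equiv.trans_apply, Equiv.symm_apply_apply]
    rfl
  refine ⟨finSumFinEquiv.symm.trans (Equiv.ofBijective κ hb), τ, hτ, ?_, ?_, ?_⟩
  · intro q
    rw [hl]; exact (e q).2
  · intro q
    rw [hl, hh]
  · intro p hp
    exact ⟨e.symm ⟨p, hp⟩, by rw [hl]; simp⟩

theorem exists_Q_ne (hcard : ω.card = n + n) (hinj : Function.Injective f)
    (hmem : ∀ p, f p ∈ ω) (hev : ∀ i, Even (ω.rowLen i)) :
    ∃ g : Equiv.Perm (Fin (n + n)),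
      Q 1 (rw' hmem) (MonoidAlgebra.of ℂ _ g * CS (fun p => (f p).2)) ≠ 0 := by
  classical
  obtain ⟨u, τ, hτ, hul, huh, hE⟩ := exists_partner hcard hinj hmem hev
  refine ⟨u⁻¹, ?_⟩
  have hmon : ∀ ψ : Fin (n + n) → Fin (ω.colLen 0), mon (1 : Matrix _ _ ℂ) ψ =
      if ∀ q, ψ (lowIdx n q) = ψ (highIdx n q) then 1 else 0 := by
    intro ψ
    rw [mon]
    split_ifs with h
    · exact Finset.prod_eq_one fun q _ => by rw [h q, Matrix.one_apply_eq]
    · push Not at h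
      obtain ⟨q, hq⟩ := h
      exact Finset.prod_eq_zero (Finset.mem_univ q) (Matrix.one_apply_ne hq)
  have hsum : Q 1 (rw' hmem) (MonoidAlgebra.of ℂ _ u⁻¹ * CS (fun p => (f p).2)) =
      ∑ σ ∈ stab (fun p => (f p).2), if (∀ q, rw' hmem (σ⁻¹ (u (lowIdx n q))) =
        rw' hmem (σ⁻¹ (u (highIdx n q)))) then (1 : ℂ) else 0 := by
    rw [CS, Finset.mul_sum, map_sum]
    refine Finset.sum_congr rfl fun σ hσ => ?_
    rw [mul_smul_comm, map_smul, ← map_mul, Q, Lf_of, hmon]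
    simp only [mul_inv_rev, inv_inv, Equiv.Perm.mul_apply]
    split_ifs with h
    · have hcol : ∀ p, (f (σ⁻¹ p)).2 = (f p).2 := mem_stab.mp (inv_mem_stab hσ)
      have hq : ∀ q, ∃ q', (u⁻¹ * σ⁻¹ * u) (lowIdx n q) = lowIdx n q' ∧
          (u⁻¹ * σ⁻¹ * u) (highIdx n q) = highIdx n q' := by
        intro q
        obtain ⟨q', hq'⟩ := hE (σ⁻¹ (u (lowIdx n q))) (by rw [hcol]; exact hul q)
        refine ⟨q', by simp only [Equiv.Perm.mul_apply]; rw [hq']; simp, ?_⟩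
        have h1 : σ⁻¹ (u (highIdx n q)) = u (highIdx n q') := by
          apply hinj
          have h2 : (f (σ⁻¹ (u (lowIdx n q)))).1 = (f (σ⁻¹ (u (highIdx n q)))).1 :=
            congrArg Fin.val (h q)
          rw [huh q', hτ, ← hq', h2, hcol]
          refine Prod.ext rfl ?_
          rw [hcol, huh, hτ]
        simp only [Equiv.Perm.mul_apply]; rw [h1]; simp
      have hH : u⁻¹ * σ⁻¹ * u ∈ hyperoctahedral n := by
        rw [mem_hyp]
        intro q
        obtain ⟨q', a, b⟩ := hq q
        rw [a, b, pair_low]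
      have hs := sign_of_low hH (fun q => (hq q).imp fun _ h => h.1)
      have hs' : sg σ = 1 := by
        have h3 : sg (u⁻¹ * σ⁻¹ * u) = 1 := by rw [sg, hs]; simp
        rw [sg_mul, sg_mul, sg_inv, sg_inv, mul_comm (sg u), mul_assoc, sg_sq, mul_one] at h3
        exact h3
      rw [hs']; simp
    · simp
  rw [hsum, Finset.sum_ite, Finset.sum_const_zero, add_zero, Finset.sum_const, nsmul_one]
  have : (1 : Equiv.Perm (Fin (n + n))) ∈ (stab (fun p => (f p).2)).filter
      (fun σ => ∀ q, rw' hmem (σ⁻¹ (u (lowIdx n q))) = rw' hmem (σ⁻¹ (u (highIdx n q)))) := by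
    rw [Finset.mem_filter]
    refine ⟨one_mem_stab, fun q => ?_⟩
    apply Fin.ext
    simp [rw', huh, hτ]
  exact_mod_cast (Finset.card_pos.mpr ⟨_, this⟩).ne'

theorem mem_specht {w : MonoidAlgebra ℂ (Equiv.Perm (Fin (n + n)))} :
    w ∈ spechtIdeal (n + n) f ↔
      ∃ x, w = x * (CS (fun p => (f p).2) * RS (fun p => (f p).1)) := by
  rw [spechtIdeal, LinearMap.mem_range, young_eq]
  simp only [LinearMap.mulRight_apply, eq_comm]

theorem plus_uniq (hcard : ω.card = n + n) (hinj : Function.Injective f) (hmem : ∀ p, f p ∈ ω)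
    {w : MonoidAlgebra ℂ (Equiv.Perm (Fin (n + n)))} (hw : w ∈ spechtIdeal (n + n) f)
    (hinv : ∀ h ∈ hyperoctahedral n, MonoidAlgebra.of ℂ _ h * w = w)
    (h1 : Q 1 (rw' hmem) w = 0) : w = 0 := by
  obtain ⟨x, hx⟩ := mem_specht.mp hw
  exact core (rigid hcard hinj hmem) (x := x) hx hinv h1

theorem plus_iff (hcard : ω.card = n + n) (hinj : Function.Injective f) (hmem : ∀ p, f p ∈ ω) :
    (∃ w ∈ spechtIdeal (n + n) f, w ≠ 0 ∧ ∀ h ∈ hyperoctahedral n,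
        MonoidAlgebra.of ℂ (Equiv.Perm (Fin (n + n))) h * w = w)
      ↔ ∀ i, Even (ω.rowLen i) := by
  constructor
  · rintro ⟨w, hw, h0, hinv⟩
    have h1 : Q 1 (rw' hmem) w ≠ 0 := fun h => h0 (plus_uniq hcard hinj hmem hw hinv h)
    obtain ⟨x, hx⟩ := mem_specht.mp hw
    apply even_of_inv hcard hinj hmem (x := x)
    intro h2
    apply h1
    have h3 := Q_RS 1 (rw' hmem) (x * CS (fun p => (f p).2))
    rw [h2, mul_zero, mul_assoc] at h3
    rw [hx]
    exact h3
  · intro hev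
    obtain ⟨g, hg⟩ := exists_Q_ne hcard hinj hmem hev
    set y := MonoidAlgebra.of ℂ _ g * CS (fun p => (f p).2) with hy
    refine ⟨∑ h ∈ hyperoctahedral n, MonoidAlgebra.of ℂ _ h * (y * RS (fun p => (f p).1)),
      ?_, ?_, ?_⟩
    · rw [mem_specht]
      refine ⟨(∑ h ∈ hyperoctahedral n, MonoidAlgebra.of ℂ _ h) * MonoidAlgebra.of ℂ _ g, ?_⟩
      rw [← Finset.sum_mul, hy, mul_assoc, mul_assoc]
    · intro h0
      have h1 := congrArg (Q 1 (rw' hmem)) h0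
      rw [map_sum, map_zero] at h1
      have hsymm : ∀ i j, (1 : Matrix (Fin (ω.colLen 0)) (Fin (ω.colLen 0)) ℂ) i j =
          (1 : Matrix (Fin (ω.colLen 0)) (Fin (ω.colLen 0)) ℂ) j i := by
        intro i j
        simp [Matrix.one_apply, eq_comm]
      rw [Finset.sum_congr rfl (fun h hh => Q_of_mul hsymm _ _ hh), Finset.sum_const,
        nsmul_eq_mul] at h1
      have h2 : Q 1 (rw' hmem) (y * RS (fun p => (f p).1)) = _ := Q_RS 1 (rw' hmem) y
      rw [h2] at h1
      have hN := card_stab_ne (fun p => (rw' hmem p : ℕ))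
      have hH : ((hyperoctahedral n).card : ℂ) ≠ 0 := by
        exact_mod_cast (Finset.card_pos.mpr ⟨1, hyp_one⟩).ne'
      exact mul_ne_zero hH (mul_ne_zero hN hg) h1
    · intro h hh
      rw [Finset.mul_sum]
      simp_rw [← mul_assoc, ← map_mul]
      refine Finset.sum_equiv (Equiv.mulLeft h) (fun σ => ?_) (fun σ _ => rfl)
      simp only [Equiv.coe_mulLeft]
      refine ⟨fun h' => hyp_mul hh h', fun h' => ?_⟩
      have := hyp_mul (hyp_inv hh) h'
      simpa using this

theorem plus_unique (hcard : ω.card = n + n) (hinj : Function.Injective f) (hmem : ∀ p, f p ∈ ω)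
    {w w' : MonoidAlgebra ℂ (Equiv.Perm (Fin (n + n)))} (hw : w ∈ spechtIdeal (n + n) f)
    (hw' : w' ∈ spechtIdeal (n + n) f) (h0 : w ≠ 0)
    (hinv : ∀ h ∈ hyperoctahedral n, MonoidAlgebra.of ℂ _ h * w = w)
    (hinv' : ∀ h ∈ hyperoctahedral n, MonoidAlgebra.of ℂ _ h * w' = w') :
    ∃ c : ℂ, w' = c • w := by
  have h1 : Q 1 (rw' hmem) w ≠ 0 := fun h => h0 (plus_uniq hcard hinj hmem hw hinv h)
  refine ⟨Q 1 (rw' hmem) w' / Q 1 (rw' hmem) w, ?_⟩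
  rw [← sub_eq_zero]
  refine plus_uniq hcard hinj hmem (Submodule.sub_mem _ hw' (Submodule.smul_mem _ _ hw)) ?_ ?_
  · intro h hh
    rw [mul_sub, mul_smul_comm, hinv h hh, hinv' h hh]
  · rw [map_sub, map_smul, smul_eq_mul, div_mul_cancel₀ _ h1, sub_self]

/-- From antiinvariants for `f` to invariants for the transposed filling. -/
noncomputable def Phi (f : Fin (n + n) → ℕ × ℕ) (w : MonoidAlgebra ℂ (Equiv.Perm (Fin (n + n)))) :
    MonoidAlgebra ℂ (Equiv.Perm (Fin (n + n))) :=
  twist (n + n) w * RS (fun p => (f p).2)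

theorem Phi_mem {w : MonoidAlgebra ℂ (Equiv.Perm (Fin (n + n)))} (hw : w ∈ spechtIdeal (n + n) f) :
    Phi f w ∈ spechtIdeal (n + n) (fun p => (f p).swap) := by
  obtain ⟨x, rfl⟩ := mem_specht.mp hw
  rw [mem_specht]
  refine ⟨twist (n + n) x * RS (fun p => (f p).2), ?_⟩
  rw [Phi, map_mul, map_mul, twist_CS, twist_RS]
  simp only [Prod.fst_swap, Prod.snd_swap, mul_assoc]

theorem Phi_zero {w : MonoidAlgebra ℂ (Equiv.Perm (Fin (n + n)))} (hw : w ∈ spechtIdeal (n + n) f)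
    (h : Phi f w = 0) : w = 0 := by
  obtain ⟨x, hx⟩ := mem_specht.mp hw
  have h1 : twist (n + n) w = 0 :=
    inj_aux (RS_adj _) (CS_adj (fun p => (f p).1)) (CS_sq _) (x := twist (n + n) x)
      (by rw [hx, map_mul, map_mul, twist_CS, twist_RS]) h
  rw [← twist_twist w, h1, map_zero]

theorem Phi_inv {w : MonoidAlgebra ℂ (Equiv.Perm (Fin (n + n)))}
    (hinv : ∀ h ∈ hyperoctahedral n, MonoidAlgebra.of ℂ _ h * w = chiMinus n h • w) :
    ∀ h ∈ hyperoctahedral n, MonoidAlgebra.of ℂ _ h * Phi f w = Phi f w := by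
  intro h hh
  have h1 := congrArg (twist (n + n)) (hinv h hh)
  rw [map_mul, map_smul, twist_of, ← sg_eq_chi hh, smul_mul_assoc] at h1
  have h2 := congrArg (fun y => sg h • y) h1
  simp only [smul_smul, sg_sq, one_smul] at h2
  rw [Phi, ← mul_assoc, h2]

theorem transpose_card (ω : YoungDiagram) : ω.transpose.card = ω.card := by
  simp [YoungDiagram.transpose, YoungDiagram.card]

end Main

end HypOct

/-- **Existence and uniqueness of the `H_n`-(anti)invariant vectors in `W_ω`**:
the irreducible `S_{2n}`-module `W_ω` contains a nonzero vector `w₊` with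
`σ·w₊ = χ₊(σ)·w₊` for all `σ ∈ H_n` iff every row of `ω` has even length, and
a nonzero vector `w₋` with `σ·w₋ = χ₋(σ)·w₋` for all `σ ∈ H_n` iff every column
of `ω` has even length; in each case the vector is unique up to a scalar. -/
theorem hyperoctahedral_invariant_vector (n : ℕ) (ω : YoungDiagram)
    (hcard : ω.card = n + n) (f : Fin (n + n) → ℕ × ℕ)
    (hinj : Function.Injective f) (hmem : ∀ p, f p ∈ ω) :
    ((∃ w ∈ spechtIdeal (n + n) f, w ≠ 0 ∧ ∀ h ∈ hyperoctahedral n,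
        MonoidAlgebra.of ℂ (Equiv.Perm (Fin (n + n))) h * w = w)
      ↔ ∀ i, Even (ω.rowLen i)) ∧
    (∀ w w', w ∈ spechtIdeal (n + n) f → w' ∈ spechtIdeal (n + n) f →
      w ≠ 0 → w' ≠ 0 →
      (∀ h ∈ hyperoctahedral n, MonoidAlgebra.of ℂ (Equiv.Perm (Fin (n + n))) h * w = w) →
      (∀ h ∈ hyperoctahedral n, MonoidAlgebra.of ℂ (Equiv.Perm (Fin (n + n))) h * w' = w') →
      ∃ c : ℂ, w' = c • w) ∧
    ((∃ w ∈ spechtIdeal (n + n) f, w ≠ 0 ∧ ∀ h ∈ hyperoctahedral n,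
        MonoidAlgebra.of ℂ (Equiv.Perm (Fin (n + n))) h * w = chiMinus n h • w)
      ↔ ∀ j, Even (ω.colLen j)) ∧
    (∀ w w', w ∈ spechtIdeal (n + n) f → w' ∈ spechtIdeal (n + n) f →
      w ≠ 0 → w' ≠ 0 →
      (∀ h ∈ hyperoctahedral n,
        MonoidAlgebra.of ℂ (Equiv.Perm (Fin (n + n))) h * w = chiMinus n h • w) →
      (∀ h ∈ hyperoctahedral n,
        MonoidAlgebra.of ℂ (Equiv.Perm (Fin (n + n))) h * w' = chiMinus n h • w') →
      ∃ c : ℂ, w' = c • w) := by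
  have hcard' : ω.transpose.card = n + n := by rw [HypOct.transpose_card, hcard]
  have hinj' : Function.Injective (fun p => (f p).swap) := Prod.swap_injective.comp hinj
  have hmem' : ∀ p, (f p).swap ∈ ω.transpose := fun p => by
    rw [YoungDiagram.mem_transpose, Prod.swap_swap]; exact hmem p
  have hplus := HypOct.plus_iff hcard' hinj' hmem'
  simp only [YoungDiagram.rowLen_transpose] at hplus
  refine ⟨HypOct.plus_iff hcard hinj hmem, ?_, ?_, ?_⟩
  · intro w w' hw hw' h0 _ h1 h2
    exact HypOct.plus_unique hcard hinj hmem hw hw' h0 h1 h2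
  · rw [← hplus]
    constructor
    · rintro ⟨w, hw, h0, h1⟩
      exact ⟨HypOct.Phi f w, HypOct.Phi_mem hw, fun h => h0 (HypOct.Phi_zero hw h),
        HypOct.Phi_inv h1⟩
    · rintro ⟨w, hw, h0, h1⟩
      obtain ⟨x, hx⟩ := HypOct.mem_specht.mp hw
      simp only [Prod.fst_swap, Prod.snd_swap] at hx
      refine ⟨HypOct.twist (n + n) (w * HypOct.CS (fun p => (f p).1)), ?_, ?_, ?_⟩
      · rw [HypOct.mem_specht]
        refine ⟨HypOct.twist (n + n) (x * HypOct.CS (fun p => (f p).1)), ?_⟩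
        rw [← HypOct.twist_CS (fun p => (f p).1), ← HypOct.twist_RS (fun p => (f p).2),
          ← map_mul, ← map_mul, hx]
        simp only [mul_assoc]
      · intro h
        apply h0
        have h2 := congrArg (HypOct.twist (n + n)) h
        rw [HypOct.twist_twist, map_zero] at h2
        exact HypOct.inj_aux (HypOct.CS_adj _) (HypOct.RS_adj _) (HypOct.RS_sq _) hx h2
      · intro h hh
        have h3 : MonoidAlgebra.of ℂ (Equiv.Perm (Fin (n + n))) h =
            HypOct.sg h • HypOct.twist (n + n) (MonoidAlgebra.of ℂ _ h) := by
          rw [HypOct.twist_of, smul_smul, HypOct.sg_sq, one_smul]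
        rw [h3, smul_mul_assoc, ← map_mul, ← mul_assoc, h1 h hh, HypOct.sg_eq_chi hh]
  · intro w w' hw hw' h0 _ h1 h2
    obtain ⟨c, hc⟩ := HypOct.plus_unique hcard' hinj' hmem' (HypOct.Phi_mem hw)
      (HypOct.Phi_mem hw') (fun h => h0 (HypOct.Phi_zero hw h)) (HypOct.Phi_inv h1)
      (HypOct.Phi_inv h2)
    refine ⟨c, ?_⟩
    rw [← sub_eq_zero]
    refine HypOct.Phi_zero (Submodule.sub_mem _ hw' (Submodule.smul_mem _ c hw)) ?_
    have h3 : HypOct.Phi f (w' - c • w) = HypOct.Phi f w' - c • HypOct.Phi f w := by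
      simp only [HypOct.Phi, map_sub, map_smul, sub_mul, smul_mul_assoc]
    rw [h3, hc, sub_self]
end

section
/- If the plethysm coefficient L_{μν} in the expansion s_μ(y_1²,...,y_N²) = Σ_ν L_{μν} s_ν(y_1,...,y_N) is nonzero, then the Young diagram of ν can be tiled by dominoes (horizontal and vertical blocks of two boxes). -/
open MvPolynomial

/-- The Vandermonde polynomial `∏_{i<j} (y_i - y_j)`. -/
noncomputable def vandermondePoly (N : ℕ) : MvPolynomial (Fin N) ℂ :=
  ∏ i : Fin N, ∏ j ∈ Finset.Ioi i, (X i - X j)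

/-- Two boxes of a Young diagram are adjacent (horizontally or vertically). -/
def AdjacentBox {N : ℕ} (c d : Fin N × ℕ) : Prop :=
  (c.1 = d.1 ∧ (c.2 + 1 = d.2 ∨ d.2 + 1 = c.2)) ∨
  (c.2 = d.2 ∧ ((c.1 : ℕ) + 1 = (d.1 : ℕ) ∨ (d.1 : ℕ) + 1 = (c.1 : ℕ)))

/-- The Young diagram of the partition `ν` can be tiled by dominoes: there is a
fixed-point-free involutive matching of its boxes into adjacent pairs. -/
def Dominoable {N : ℕ} (ν : Fin N → ℕ) : Prop :=
  ∃ f : Fin N × ℕ → Fin N × ℕ,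
    (∀ c : Fin N × ℕ, c.2 < ν c.1 → (f c).2 < ν (f c).1) ∧
    (∀ c : Fin N × ℕ, c.2 < ν c.1 → f (f c) = c) ∧
    (∀ c : Fin N × ℕ, c.2 < ν c.1 → f c ≠ c ∧ AdjacentBox c (f c))


def AdjB (c d : ℕ × ℕ) : Prop :=
  (c.1 = d.1 ∧ (c.2 + 1 = d.2 ∨ d.2 + 1 = c.2)) ∨
  (c.2 = d.2 ∧ (c.1 + 1 = d.1 ∨ d.1 + 1 = c.1))

def TiledSet (P : ℕ × ℕ → Prop) : Prop :=
  ∃ f : ℕ × ℕ → ℕ × ℕ, ∀ c, P c → P (f c) ∧ f (f c) = c ∧ f c ≠ c ∧ AdjB c (f c)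

lemma TiledSet.add {P Q : ℕ × ℕ → Prop} (hP : TiledSet P) (a b : ℕ × ℕ)
    (hab : a ≠ b) (hadj : AdjB a b) (ha : ¬ P a) (hb : ¬ P b)
    (hQ : ∀ c, Q c ↔ P c ∨ c = a ∨ c = b) : TiledSet Q := by
  obtain ⟨f, hf⟩ := hP
  have hadj' : AdjB b a := by
    unfold AdjB at *; omega
  refine ⟨fun c => if c = a then b else if c = b then a else f c, ?_⟩
  intro c hc
  rcases (hQ c).1 hc with h | rfl | rfl
  · obtain ⟨h1, h2, h3, h4⟩ := hf c h
    have e1 : c ≠ a := fun h' => ha (h' ▸ h)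
    have e2 : c ≠ b := fun h' => hb (h' ▸ h)
    have e3 : f c ≠ a := fun h' => ha (h' ▸ h1)
    have e4 : f c ≠ b := fun h' => hb (h' ▸ h1)
    simp only [e1, e2, e3, e4, if_false]
    exact ⟨(hQ _).2 (Or.inl h1), h2, h3, h4⟩
  · have : b ≠ c := hab.symm
    simp [this, hadj, hQ]
  · simp [hab, hab.symm, hadj', hQ]

lemma stair_sum (k N : ℕ) (hk : k ≤ N)
    (h : ∑ i ∈ Finset.range N, (-1 : ℤ) ^ ((k - i) + i) = ∑ i ∈ Finset.range N, (-1 : ℤ) ^ i) :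
    k = 0 := by
  have h1 : ∑ i ∈ Finset.range k, (-1 : ℤ) ^ ((k - i) + i) = ∑ i ∈ Finset.range k, (-1 : ℤ) ^ i := by
    induction N, hk using Nat.le_induction with
    | base => exact h
    | succ n hn ih =>
      apply ih
      rw [Finset.sum_range_succ, Finset.sum_range_succ] at h
      rw [Nat.sub_eq_zero_of_le hn, zero_add] at h
      linarith
  have h2 : ∑ i ∈ Finset.range k, (-1 : ℤ) ^ ((k - i) + i) = k * (-1) ^ k := by
    rw [Finset.sum_congr rfl (g := fun _ => (-1 : ℤ) ^ k)]
    · simp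
    · intro i hi
      rw [Nat.sub_add_cancel (Finset.mem_range.1 hi).le]
  rw [h2, neg_one_geom_sum] at h1
  rcases Nat.even_or_odd k with he | ho
  · simp [he, he.neg_one_pow] at h1
    exact h1
  · simp [Nat.not_even_iff_odd.2 ho, ho.neg_one_pow] at h1
    omega

lemma domino_nat (N : ℕ) : ∀ n : ℕ, ∀ ν : ℕ → ℕ, ∑ i ∈ Finset.range N, ν i = n →
    (∀ i, ν (i + 1) ≤ ν i) → (∀ i, N ≤ i → ν i = 0) →
    ∑ i ∈ Finset.range N, (-1 : ℤ) ^ (ν i + i) = ∑ i ∈ Finset.range N, (-1 : ℤ) ^ i →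
    TiledSet (fun c => c.2 < ν c.1) := by
  intro n
  induction n using Nat.strong_induction_on with
  | _ n ih =>
  intro ν hn hanti hzero hsgn
  by_cases hA : ∃ i, ν (i + 1) + 2 ≤ ν i
  · obtain ⟨i, hi⟩ := hA
    have hiN : i < N := by
      by_contra h
      have := hzero i (by omega)
      omega
    set ν' : ℕ → ℕ := fun j => if j = i then ν i - 2 else ν j with hν'
    have T : TiledSet (fun c => c.2 < ν' c.1) := by
      refine ih (∑ i ∈ Finset.range N, ν' i) ?_ ν' rfl ?_ ?_ ?_
      · rw [← hn]
        apply Finset.sum_lt_sum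
        · intro j _
          simp only [hν']; split_ifs with h
          · subst h; omega
          · exact le_rfl
        · exact ⟨i, Finset.mem_range.2 hiN, by simp [hν']; omega⟩
      · intro j
        have := hanti j
        simp only [hν']; split_ifs with h h' h'
        · omega
        · subst h; omega
        · subst h'; omega
        · exact this
      · intro j hj
        have := hzero j hj
        simp only [hν']; split_ifs with h
        · omega
        · exact this
      · rw [← hsgn]
        apply Finset.sum_congr rfl
        intro j _
        simp only [hν']; split_ifs with h
        · subst h
          obtain ⟨t, ht⟩ := Nat.exists_eq_add_of_le (show 2 ≤ ν j by omega)
          rw [ht, show 2 + t - 2 + j = t + j by omega, show 2 + t + j = t + j + 2 by omega,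
            pow_add _ (t + j) 2]
          norm_num
        · rfl
    refine T.add (i, ν i - 2) (i, ν i - 1) ?_ ?_ ?_ ?_ ?_
    · simp; omega
    · left; simp; omega
    · simp [hν']
    · simp [hν']; omega
    · rintro ⟨x, y⟩
      simp only [hν', Prod.mk.injEq]
      split_ifs with h
      · subst h; omega
      · simp [h]
  by_cases hB : ∃ i, ν i = ν (i + 1) ∧ ν (i + 2) < ν (i + 1)
  · obtain ⟨i, hi, hi2⟩ := hB
    have hiN : i + 1 < N := by
      by_contra h
      have := hzero (i + 1) (by omega)
      omega
    set ν' : ℕ → ℕ := fun j => if j = i ∨ j = i + 1 then ν j - 1 else ν j with hν'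
    have T : TiledSet (fun c => c.2 < ν' c.1) := by
      refine ih (∑ i ∈ Finset.range N, ν' i) ?_ ν' rfl ?_ ?_ ?_
      · rw [← hn]
        apply Finset.sum_lt_sum
        · intro j _
          simp only [hν']; split_ifs with h
          · omega
          · exact le_rfl
        · exact ⟨i, Finset.mem_range.2 (by omega), by simp [hν']; omega⟩
      · intro j
        have := hanti j
        simp only [hν']; split_ifs with h h' h'
        · omega
        · omega
        · have : j = i + 1 := by omega
          subst this
          have : ν (i + 1 + 1) < ν (i + 1) := hi2
          omega
        · exact this
      · intro j hj
        have := hzero j hj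
        simp only [hν']; split_ifs with h
        · omega
        · exact this
      · rw [← hsgn]
        have hsub : ({i, i + 1} : Finset ℕ) ⊆ Finset.range N := by
          intro x hx
          simp at hx
          simp; omega
        rw [← Finset.sum_sdiff hsub, ← Finset.sum_sdiff hsub]
        congr 1
        · apply Finset.sum_congr rfl
          intro j hj
          simp only [Finset.mem_sdiff, Finset.mem_insert, Finset.mem_singleton] at hj
          simp [hν', hj.2]
        · rw [Finset.sum_pair (by omega), Finset.sum_pair (by omega)]
          simp only [hν', true_or, or_true, if_true, ← hi]
          obtain ⟨t, ht⟩ := Nat.exists_eq_add_of_le (show 1 ≤ ν i by omega)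
          rw [ht, show 1 + t - 1 = t by omega]
          ring
    refine T.add (i, ν i - 1) (i + 1, ν i - 1) ?_ ?_ ?_ ?_ ?_
    · simp
    · right; simp
    · simp [hν']
    · simp [hν']; omega
    · rintro ⟨x, y⟩
      simp only [hν', Prod.mk.injEq]
      split_ifs with h
      · rcases h with rfl | rfl <;> omega
      · have h1 : x ≠ i := by omega
        have h2 : x ≠ i + 1 := by omega
        simp [h1, h2]
  push Not at hA hB
  have hconst : ∀ i, ν i = ν (i + 1) → ∀ j, ν (i + j) = ν i ∧ ν (i + j + 1) = ν i := by
    intro i h j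
    induction j with
    | zero => exact ⟨rfl, h.symm⟩
    | succ j ihj =>
      obtain ⟨h1, h2⟩ := ihj
      have h3 := hB (i + j) (by omega)
      have h4 := hanti (i + j + 1)
      have e1 : i + (j + 1) = i + j + 1 := by omega
      rw [e1]
      refine ⟨h2, ?_⟩
      have h3' : ν (i + j + 1) ≤ ν (i + j + 1 + 1) := h3
      omega
  have hstep : ∀ i, ν (i + 1) = ν i - 1 := by
    intro i
    have h1 := hA i
    have h2 := hanti i
    by_cases h : ν i = ν (i + 1)
    · have := (hconst i h N).1
      rw [hzero (i + N) (by omega)] at this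
      omega
    · omega
  have hst : ∀ i, ν i = ν 0 - i := by
    intro i
    induction i with
    | zero => rfl
    | succ i ihi => rw [hstep, ihi]; omega
  have h0 : ν 0 = 0 := by
    apply stair_sum (ν 0) N
    · have := hst N
      rw [hzero N le_rfl] at this
      omega
    · rw [← hsgn]
      exact Finset.sum_congr rfl fun i _ => by rw [← hst i]
  refine ⟨id, fun c hc => ?_⟩
  have hc' : c.2 < ν c.1 := hc
  rw [hst, h0] at hc'
  omega

/-- The sign condition implies that the diagram is tileable. -/
lemma dominoable_of_sign {N : ℕ} (ν : Fin N → ℕ) (hν : Antitone ν)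
    (h : ∑ i : Fin N, (-1 : ℤ) ^ (ν i + (i : ℕ)) = ∑ i : Fin N, (-1 : ℤ) ^ (i : ℕ)) :
    Dominoable ν := by
  set g : ℕ → ℕ := fun n => if h : n < N then ν ⟨n, h⟩ else 0 with hg
  have hgν : ∀ i : Fin N, g i = ν i := fun i => by simp [hg]
  have hT : TiledSet (fun c => c.2 < g c.1) := by
    refine domino_nat N _ g rfl ?_ ?_ ?_
    · intro i
      simp only [hg]
      split_ifs with h1 h2
      · exact hν (by simp)
      · omega
      · exact Nat.zero_le _
      · exact le_rfl
    · intro i hi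
      simp [hg, Nat.not_lt.2 hi]
    · rw [Finset.sum_range, Finset.sum_range, ← h]
      exact Finset.sum_congr rfl fun i _ => by rw [hgν]
  obtain ⟨f, hf⟩ := hT
  have hlt : ∀ c : ℕ × ℕ, c.2 < g c.1 → c.1 < N := by
    intro c hc
    by_contra hn
    simp [hg, hn] at hc
  let F : Fin N × ℕ → Fin N × ℕ := fun c =>
    if h : (f ((c.1 : ℕ), c.2)).1 < N then (⟨_, h⟩, (f ((c.1 : ℕ), c.2)).2) else c
  have hF : ∀ c : Fin N × ℕ, c.2 < ν c.1 →
      (((F c).1 : ℕ), (F c).2) = f ((c.1 : ℕ), c.2) := by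
    intro c hc
    have h1 := hf ((c.1 : ℕ), c.2) (by simpa [hgν] using hc)
    have h2 := hlt _ h1.1
    simp [F, h2]
  have hinj : ∀ c d : Fin N × ℕ, ((c.1 : ℕ), c.2) = ((d.1 : ℕ), d.2) → c = d := by
    rintro ⟨a, b⟩ ⟨a', b'⟩ h
    simp only [Prod.mk.injEq] at h
    exact Prod.ext (Fin.ext h.1) h.2
  have hP : ∀ c : Fin N × ℕ, c.2 < ν c.1 → (F c).2 < ν (F c).1 := by
    intro c hc
    have h1 := (hf ((c.1 : ℕ), c.2) (by simpa [hgν] using hc)).1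
    rw [← hF c hc] at h1
    simpa [hgν] using h1
  refine ⟨F, hP, ?_, ?_⟩
  · intro c hc
    have h1 := (hf ((c.1 : ℕ), c.2) (by simpa [hgν] using hc)).2.1
    apply hinj
    rw [hF _ (hP c hc), hF c hc, h1]
  · intro c hc
    have h1 := (hf ((c.1 : ℕ), c.2) (by simpa [hgν] using hc)).2.2
    rw [← hF c hc] at h1
    refine ⟨fun h => h1.1 (by rw [h]), ?_⟩
    have h2 := h1.2
    unfold AdjB at h2
    unfold AdjacentBox
    rw [Fin.ext_iff]
    exact h2

lemma prod_X_pow_monomial {N : ℕ} (g : Fin N → ℕ) :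
    ∏ i, (X i : MvPolynomial (Fin N) ℂ) ^ g i = monomial (Finsupp.equivFunOnFinite.symm g) 1 := by
  rw [monomial_eq, Finsupp.prod_fintype _ _ (by simp)]
  simp

/-- Coefficients of an alternant. -/
lemma coeff_alternant {N : ℕ} (b e : Fin N → ℕ) :
    coeff (Finsupp.equivFunOnFinite.symm e)
      (Matrix.det (Matrix.of fun i j : Fin N => (X j : MvPolynomial (Fin N) ℂ) ^ b i)) =
    ∑ σ : Equiv.Perm (Fin N), ((Equiv.Perm.sign σ : ℤ) : ℂ) * if b ∘ σ = e then 1 else 0 := by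
  rw [Matrix.det_apply', coeff_sum]
  refine Finset.sum_congr rfl fun σ _ => ?_
  simp only [Matrix.of_apply]
  rw [prod_X_pow_monomial (fun i => b (σ i)),
    show (((Equiv.Perm.sign σ : ℤ) : MvPolynomial (Fin N) ℂ)) =
      C ((Equiv.Perm.sign σ : ℤ) : ℂ) by simp, coeff_C_mul, coeff_monomial]
  simp only [EmbeddingLike.apply_eq_iff_eq]
  rfl

lemma coeff_alternant_self {N : ℕ} (b : Fin N → ℕ) (hb : Function.Injective b) :
    coeff (Finsupp.equivFunOnFinite.symm b)
      (Matrix.det (Matrix.of fun i j : Fin N => (X j : MvPolynomial (Fin N) ℂ) ^ b i)) = 1 := by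
  rw [coeff_alternant, Finset.sum_eq_single 1]
  · simp
  · intro σ _ hσ
    rw [if_neg, mul_zero]
    intro h
    apply hσ
    ext i
    have := hb (congrFun h i)
    simp [this]
  · simp

lemma coeff_alternant_ne {N : ℕ} (b e : Fin N → ℕ) (hb : StrictAnti b) (he : StrictAnti e)
    (hne : b ≠ e) :
    coeff (Finsupp.equivFunOnFinite.symm e)
      (Matrix.det (Matrix.of fun i j : Fin N => (X j : MvPolynomial (Fin N) ℂ) ^ b i)) = 0 := by
  rw [coeff_alternant]
  refine Finset.sum_eq_zero fun σ _ => ?_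
  rw [if_neg, mul_zero]
  intro h
  apply hne
  refine Set.range_injOn_strictAnti hb he ?_
  rw [← h, Set.range_comp, σ.surjective.range_eq, Set.image_univ]

lemma vandermonde_coeff {N : ℕ} (a : Fin N →₀ ℕ) (ha : coeff a (vandermondePoly N) ≠ 0) :
    ∃ σ : Equiv.Perm (Fin N), ∀ i, a i = (σ i : ℕ) := by
  have hV : ∃ c : ℂ, vandermondePoly N =
      C c * Matrix.det (Matrix.of fun i j : Fin N =>
        (X j : MvPolynomial (Fin N) ℂ) ^ (i : ℕ)) := by
    refine ⟨∏ i : Fin N, ∏ j ∈ Finset.Ioi i, (-1), ?_⟩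
    have h1 : Matrix.det (Matrix.of fun i j : Fin N =>
        (X j : MvPolynomial (Fin N) ℂ) ^ (i : ℕ)) =
        Matrix.det (Matrix.vandermonde (X : Fin N → MvPolynomial (Fin N) ℂ)) := by
      rw [← Matrix.det_transpose]; rfl
    rw [h1, Matrix.det_vandermonde, vandermondePoly, map_prod, ← Finset.prod_mul_distrib]
    refine Finset.prod_congr rfl fun i _ => ?_
    rw [map_prod, ← Finset.prod_mul_distrib]
    refine Finset.prod_congr rfl fun j _ => ?_
    simp
  obtain ⟨c, hc⟩ := hV
  rw [hc, coeff_C_mul] at ha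
  have ha := right_ne_zero_of_mul ha
  rw [← Finsupp.equivFunOnFinite.symm_apply_apply a,
    coeff_alternant (fun i : Fin N => (i : ℕ))] at ha
  obtain ⟨σ, _, hσ⟩ := Finset.exists_ne_zero_of_sum_ne_zero ha
  refine ⟨σ, fun i => ?_⟩
  by_contra hne
  apply hσ
  rw [if_neg, mul_zero]
  intro h
  exact hne (congrFun h i).symm

/-- **Littlewood's domino criterion for the plethysm `s_μ ∘ p_2`**: if the
coefficient `L_{μν}` of the Schur polynomial `s_ν(y_1,…,y_N)` in the expansion of
`s_μ(y_1²,…,y_N²)` is nonzero, then the Young diagram of `ν` can be tiled by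
dominoes.  (Here the Schur polynomials `S κ` are characterized by
`(∏_{i<j}(y_i-y_j))·S κ = det[y_j^{κ_i+N-i}]`.) -/
theorem plethysm_nonzero_domino (N m : ℕ) (μ : Fin N → ℕ)
    (hμ : Antitone μ) (hμsum : ∑ i, μ i = m)
    (S : (Fin N → ℕ) → MvPolynomial (Fin N) ℂ)
    (hS : ∀ κ : Fin N → ℕ,
      vandermondePoly N * S κ =
        Matrix.det (Matrix.of fun i j : Fin N => (X j) ^ (κ i + (N - 1 - (i : ℕ)))))
    (L : (Fin N → ℕ) → ℂ)
    (hL0 : ∀ ν : Fin N → ℕ, ¬(Antitone ν ∧ ∑ i, ν i = 2 * m) → L ν = 0)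
    (hexp : MvPolynomial.aeval (fun i => (X i) ^ 2) (S μ) = ∑ᶠ ν : Fin N → ℕ, L ν • S ν)
    (ν : Fin N → ℕ) (hν : L ν ≠ 0) :
    Dominoable ν := by
  set β : (Fin N → ℕ) → Fin N → ℕ := fun κ i => κ i + (N - 1 - (i : ℕ)) with hβ
  have hβanti : ∀ κ : Fin N → ℕ, Antitone κ → StrictAnti (β κ) := by
    intro κ hκ i j hij
    have h1 := hκ hij.le
    have h2 : (i : ℕ) < j := hij
    have h3 := j.isLt
    simp only [hβ]
    omega
  have hβinj : ∀ κ κ', β κ = β κ' → κ = κ' := by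
    intro κ κ' h
    funext i
    have := congrFun h i
    simpa [hβ] using this
  have hmem : ∀ κ, L κ ≠ 0 → Antitone κ ∧ ∑ i, κ i = 2 * m := fun κ hκ => by
    by_contra h
    exact hκ (hL0 κ h)
  have hνm := hmem ν hν
  set s : Finset (Fin N → ℕ) := Finset.Iic (fun _ => 2 * m) with hs
  have hms : ∀ κ, L κ ≠ 0 → κ ∈ s := by
    intro κ hκ
    rw [hs, Finset.mem_Iic]
    intro i
    rw [← (hmem κ hκ).2]
    exact Finset.single_le_sum (f := κ) (fun _ _ => Nat.zero_le _) (Finset.mem_univ i)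
  have hsum : ∑ᶠ κ : Fin N → ℕ, L κ • S κ = ∑ κ ∈ s, L κ • S κ := by
    apply finsum_eq_sum_of_support_subset
    intro κ hκ
    apply hms
    intro h0
    apply hκ
    simp [h0]
  have hcoef : coeff (Finsupp.equivFunOnFinite.symm (β ν))
      (vandermondePoly N * expand 2 (S μ)) = L ν := by
    have he : expand 2 (S μ) = ∑ κ ∈ s, L κ • S κ := by
      rw [← hsum, ← hexp]; rfl
    rw [he, Finset.mul_sum, coeff_sum, Finset.sum_eq_single ν]
    · rw [mul_smul_comm, coeff_smul, hS, coeff_alternant_self (β ν) (hβanti ν hνm.1).injective]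
      simp
    · intro κ _ hκ
      rw [mul_smul_comm, coeff_smul, hS]
      by_cases h : L κ = 0
      · simp [h]
      · rw [coeff_alternant_ne (β κ) (β ν) (hβanti κ (hmem κ h).1) (hβanti ν hνm.1)
          (fun h => hκ (hβinj _ _ h)), smul_zero]
    · intro h
      exact absurd (hms ν hν) h
  rw [← hcoef, coeff_mul] at hν
  obtain ⟨⟨a, b⟩, hab, hne⟩ := Finset.exists_ne_zero_of_sum_ne_zero hν
  rw [Finset.HasAntidiagonal.mem_antidiagonal] at hab
  simp only at hab hne
  obtain ⟨σ, hσ⟩ := vandermonde_coeff a (left_ne_zero_of_mul hne)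
  have hb : ∀ i, 2 ∣ b i := by
    intro i
    by_contra h
    exact right_ne_zero_of_mul hne (coeff_expand_of_not_dvd (p := 2) (S μ) h)
  have hpar : ∀ i, (-1 : ℤ) ^ (ν i + (N - 1 - (i : ℕ))) = (-1) ^ (σ i : ℕ) := by
    intro i
    have h1 : a i + b i = ν i + (N - 1 - (i : ℕ)) := by
      have := DFunLike.congr_fun hab i
      simpa [hβ] using this
    obtain ⟨t, ht⟩ := hb i
    rw [← h1, hσ, ht, pow_add, pow_mul (-1 : ℤ) 2 t]
    norm_num
  apply dominoable_of_sign ν hνm.1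
  have hrow : ∀ i : Fin N, (-1 : ℤ) ^ (ν i + (i : ℕ)) = (-1) ^ (N - 1) * (-1) ^ (σ i : ℕ) := by
    intro i
    have hi := i.isLt
    rw [← hpar, ← pow_add]
    apply neg_one_pow_congr
    simp only [Nat.even_iff]
    omega
  have hrev : ∑ i : Fin N, (-1 : ℤ) ^ (i : ℕ) =
      ∑ i : Fin N, (-1 : ℤ) ^ (N - 1) * (-1) ^ (i : ℕ) := by
    rw [← Equiv.sum_comp Fin.revPerm]
    refine Finset.sum_congr rfl fun i _ => ?_
    have hi := i.isLt
    rw [← pow_add]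
    apply neg_one_pow_congr
    simp only [Nat.even_iff, Fin.revPerm_apply, Fin.val_rev]
    omega
  rw [hrev, Finset.sum_congr rfl fun i _ => hrow i]
  exact Equiv.sum_comp σ (fun i : Fin N => (-1 : ℤ) ^ (N - 1) * (-1) ^ (i : ℕ))
end
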